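/- arXiv:math/9411218 — 3 statements merged into one kernel-verified Lean document; each statement's English description precedes it below -/
import Mathlib

section
/- There exists a connected finite simple graph with exactly 355812 vertices, maximum degree at most 12, and diameter at most 6. -/
namespace SplitCayley

section

variable {K : Type*} [Field K]

/-- The symmetric bilinear form polarising `x₀x₄ + x₁x₅ + x₂x₆ - x₃²`. -/
def form (x y : Fin 7 → K) : K :=
  x 0 * y 4 + x 4 * y 0 + x 1 * y 5 + x 5 * y 1 + x 2 * y 6 + x 6 * y 2 - 2 * x 3 * y 3

/-- A multiple of the cross product of trace-zero split octonions. -/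
def cross (x y : Fin 7 → K) : Fin 7 → K :=
  ![2 * (x 5 * y 6 - x 6 * y 5 - (x 0 * y 3 - x 3 * y 0)),
    -2 * (x 4 * y 6 - x 6 * y 4 + (x 1 * y 3 - x 3 * y 1)),
    2 * (x 4 * y 5 - x 5 * y 4 - (x 2 * y 3 - x 3 * y 2)),
    -(x 0 * y 4 - x 4 * y 0 + (x 1 * y 5 - x 5 * y 1) + (x 2 * y 6 - x 6 * y 2)),
    2 * (x 1 * y 2 - x 2 * y 1 - (x 3 * y 4 - x 4 * y 3)),
    -2 * (x 0 * y 2 - x 2 * y 0 + (x 3 * y 5 - x 5 * y 3)),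
    2 * (x 0 * y 1 - x 1 * y 0 - (x 3 * y 6 - x 6 * y 3))]

lemma cross_self (x : Fin 7 → K) : cross x x = 0 := by
  ext i; fin_cases i <;> simp [-mul_eq_zero, cross] <;> ring

lemma cross_anti (x y : Fin 7 → K) : cross x y = -cross y x := by
  ext i; fin_cases i <;> simp [-mul_eq_zero, cross] <;> ring

lemma cross_comb (x y z : Fin 7 → K) (a b : K) :
    cross x (a • y + b • z) = a • cross x y + b • cross x z := by
  ext i; fin_cases i <;> simp [-mul_eq_zero, cross] <;> ring

lemma cross_smul (x y : Fin 7 → K) (a : K) : cross x (a • y) = a • cross x y := by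
  ext i; fin_cases i <;> simp [-mul_eq_zero, cross] <;> ring

lemma form_comm (x y : Fin 7 → K) : form x y = form y x := by
  simp only [form]; ring

lemma form_comb (x y z : Fin 7 → K) (a b : K) :
    form x (a • y + b • z) = a * form x y + b * form x z := by
  simp [form]; ring

lemma cross_cross_add (a b p : Fin 7 → K) :
    cross a (cross b p) + cross b (cross a p) =
      (2 * form a p) • b + (2 * form b p) • a - (4 * form a b) • p := by
  ext i; fin_cases i <;> simp [cross, form] <;> ring

lemma cross_cross (a p : Fin 7 → K) :
    cross a (cross a p) = (2 * form a p) • a - (2 * form a a) • p := by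
  ext i; fin_cases i <;> simp [cross, form] <;> ring

lemma form_cross_cross (a b : Fin 7 → K) :
    form (cross a b) (cross a b) = 2 * (form a a * form b b - form a b ^ 2) := by
  simp [cross, form]; ring

/-- The points of the split Cayley hexagon, in six Schubert cells. -/
inductive Pt (K : Type*)
  | p0
  | p1 (a : K)
  | p2 (k b : K)
  | p3 (a l a' : K)
  | p4 (k b k' b' : K)
  | p5 (a l a' l' a'' : K)

/-- The lines of the split Cayley hexagon, in six Schubert cells. -/
inductive Ln (K : Type*)
  | l0
  | l1 (k : K)
  | l2 (a l : K)
  | l3 (k b k' : K)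
  | l4 (a l a' l' : K)
  | l5 (k b k' b' k'' : K)

open Pt Ln

/-- Homogeneous coordinates of a point on the quadric. -/
def vec : Pt K → Fin 7 → K
  | p0 => ![1, 0, 0, 0, 0, 0, 0]
  | p1 a => ![a, 0, 0, 0, 0, 0, 1]
  | p2 k b => ![b, 0, 0, 0, 0, 1, -k]
  | p3 a l a' => ![-l - a * a', 1, 0, -a, 0, a ^ 2, -a']
  | p4 k b k' b' => ![k' + b * b', k, 1, b, 0, b', b ^ 2 - b' * k]
  | p5 a l a' l' a'' =>
    ![-a * l' + a' ^ 2 + a'' * l + a * a' * a'', -a'', -a, -a' + a * a'', 1,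
      l + 2 * a * a' - a ^ 2 * a'', -l' + a' * a'']

/-- The unique point of a line in the smallest cell. -/
def parent : Ln K → Pt K
  | l0 => p0
  | l1 _ => p0
  | l2 a _ => p1 a
  | l3 k b _ => p2 k b
  | l4 a l a' _ => p3 a l a'
  | l5 k b k' b' _ => p4 k b k' b'

/-- The points of a line other than its parent. -/
def child : Ln K → K → Pt K
  | l0, c => p1 c
  | l1 k, c => p2 k c
  | l2 a l, c => p3 a l c
  | l3 k b k', c => p4 k b k' c
  | l4 a l a' l', c => p5 a l a' l' c
  | l5 k b k' b' k'', a =>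
    p5 a (k'' - a ^ 3 * k + 3 * a ^ 2 * (a * k + b) - 3 * a * (b' + 2 * a * b + a ^ 2 * k))
      (b' + 2 * a * b + a ^ 2 * k)
      (k' - a ^ 3 * k ^ 2 +
        k * (k'' - a ^ 3 * k + 3 * a ^ 2 * (a * k + b) - 3 * a * (b' + 2 * a * b + a ^ 2 * k)) +
        3 * a ^ 2 * (a * k + b) * k + 3 * (b' + 2 * a * b + a ^ 2 * k) * (a * k + b) -
        3 * a * (a * k + b) ^ 2)
      (a * k + b)

def sgn : Ln K → K
  | l0 => 1
  | l1 _ => 1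
  | l2 _ _ => -1
  | l3 _ _ _ => 1
  | l4 _ _ _ _ => -1
  | l5 _ _ _ _ _ => -1

lemma sgn_mul_self (m : Ln K) : sgn m * sgn m = 1 := by
  cases m <;> simp [sgn]

/-- Incidence of points and lines. -/
def Inc (x : Pt K) (m : Ln K) : Prop := x = parent m ∨ ∃ c, x = child m c

/-- The points of a line, parametrised by the projective line. -/
def ptOf (m : Ln K) : Option K → Pt K
  | none => parent m
  | some c => child m c

/-- The lines through a point, parametrised by the projective line. -/
def lnOf : Pt K → Option K → Ln K
  | p0, none => l0
  | p0, some k => l1 k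
  | p1 _, none => l0
  | p1 a, some l => l2 a l
  | p2 k _, none => l1 k
  | p2 k b, some k' => l3 k b k'
  | p3 a l _, none => l2 a l
  | p3 a l a', some l' => l4 a l a' l'
  | p4 k b k' _, none => l3 k b k'
  | p4 k b k' b', some k'' => l5 k b k' b' k''
  | p5 a l a' l' _, none => l4 a l a' l'
  | p5 a l a' l' a'', some k =>
    l5 k (a'' - a * k)
      (l' + a ^ 3 * k ^ 2 - k * l - 3 * a ^ 2 * a'' * k - 3 * a' * a'' + 3 * a * a'' ^ 2)
      (a' - 2 * a * a'' + a ^ 2 * k)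
      (l + a ^ 3 * k - 3 * a ^ 2 * a'' + 3 * a * a')

lemma inc_ptOf (m : Ln K) (o : Option K) : Inc (ptOf m o) m := by
  cases o <;> simp [Inc, ptOf]

lemma exists_ptOf {x : Pt K} {m : Ln K} (h : Inc x m) : ∃ o, ptOf m o = x := by
  rcases h with h | ⟨c, h⟩
  · exact ⟨none, h.symm⟩
  · exact ⟨some c, h.symm⟩

lemma ptOf_injective (m : Ln K) : Function.Injective (ptOf m) := by
  intro o o' h
  cases m <;> cases o <;> cases o' <;> simp_all [ptOf, parent, child]

lemma inc_lnOf (x : Pt K) (o : Option K) : Inc x (lnOf x o) := by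
  cases x <;> cases o <;> simp [Inc, lnOf, parent, child]
  all_goals (refine ⟨?_, ?_, ?_⟩ <;> ring)

lemma exists_lnOf {x : Pt K} {m : Ln K} (h : Inc x m) : ∃ o, lnOf x o = m := by
  rcases h with rfl | ⟨c, rfl⟩
  · cases m
    · exact ⟨none, rfl⟩
    all_goals exact ⟨some _, rfl⟩
  · cases m
    case l5 k b k' b' k'' =>
      refine ⟨some k, ?_⟩
      simp only [child, lnOf, Ln.l5.injEq, true_and]
      refine ⟨?_, ?_, ?_, ?_⟩ <;> ring
    all_goals exact ⟨none, rfl⟩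

lemma lnOf_injective (x : Pt K) : Function.Injective (lnOf x) := by
  intro o o' h
  cases x <;> cases o <;> cases o' <;> simp_all [lnOf]

lemma vec_child (m : Ln K) (c : K) :
    vec (child m c) = (sgn m * c) • vec (parent m) + (1 : K) • vec (child m 0) := by
  cases m <;> ext i <;> fin_cases i <;> simp [child, parent, vec, sgn] <;> ring

lemma vec_null (x : Pt K) : form (vec x) (vec x) = 0 := by
  cases x <;> simp [form, vec] <;> ring

lemma vec_ne_zero (x : Pt K) : vec x ≠ 0 := by
  intro h
  have h' := fun i => congrFun h i
  cases x
  · simpa [vec] using h' 0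
  · simpa [vec] using h' 6
  · simpa [vec] using h' 5
  · simpa [vec] using h' 1
  · simpa [vec] using h' 2
  · simpa [vec] using h' 4

lemma cross_parent_child (m : Ln K) :
    cross (vec (parent m)) (vec (child m 0)) = 0 := by
  cases m <;> ext i <;> fin_cases i <;> simp [-mul_eq_zero, cross, child, parent, vec] <;> ring

lemma eq_of_vec_eq_smul {x y : Pt K} {c : K} (h : vec x = c • vec y) : x = y := by
  have hc : c ≠ 0 := by
    rintro rfl
    exact vec_ne_zero x (by simpa using h)
  have h' := fun i => congrFun h i
  have h0 := h' 0
  have h1 := h' 1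
  have h2 := h' 2
  have h3 := h' 3
  have h4 := h' 4
  have h5 := h' 5
  have h6 := h' 6
  clear h h'
  cases x <;> cases y <;> simp [vec] at h0 h1 h2 h3 h4 h5 h6 ⊢ <;> grind

lemma exists_vec_of_null (h2 : (2 : K) ≠ 0) {v : Fin 7 → K} (hv : v ≠ 0) (hn : form v v = 0) :
    ∃ (x : Pt K) (c : K), c ≠ 0 ∧ v = c • vec x := by
  have hn' : v 0 * v 4 + v 1 * v 5 + v 2 * v 6 = v 3 ^ 2 := by
    apply mul_left_cancel₀ h2
    simp only [form] at hn
    linear_combination hn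
  by_cases h4 : v 4 = 0
  · by_cases h2 : v 2 = 0
    · by_cases h1 : v 1 = 0
      · have h3 : v 3 = 0 := by
          rw [h4, h2, h1] at hn'
          simpa using hn'.symm
        by_cases h5 : v 5 = 0
        · by_cases h6 : v 6 = 0
          · refine ⟨p0, v 0, ?_, ?_⟩
            · intro h0
              apply hv
              ext i; fin_cases i <;> simp [*]
            · ext i; fin_cases i <;> simp [*, vec]
          · refine ⟨p1 (v 0 / v 6), v 6, h6, ?_⟩
            ext i; fin_cases i <;> simp [*, vec]
            field_simp
        · refine ⟨p2 (-(v 6 / v 5)) (v 0 / v 5), v 5, h5, ?_⟩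
          ext i; fin_cases i <;> simp [*, vec] <;> field_simp
      · refine ⟨p3 (-(v 3 / v 1)) (-(v 0 / v 1) - v 3 * v 6 / v 1 ^ 2) (-(v 6 / v 1)), v 1, h1, ?_⟩
        ext i; fin_cases i <;> simp [*, vec] <;> field_simp
        · ring
        · rw [h4, h2] at hn'
          linear_combination hn'
    · refine ⟨p4 (v 1 / v 2) (v 3 / v 2) (v 0 / v 2 - v 3 * v 5 / v 2 ^ 2) (v 5 / v 2), v 2, h2, ?_⟩
      ext i; fin_cases i <;> simp [*, vec] <;> field_simp
      · ring
      · rw [h4] at hn'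
        linear_combination hn'
  · obtain ⟨w, hw⟩ : ∃ w : Fin 7 → K, w = (v 4)⁻¹ • v := ⟨_, rfl⟩
    have hvw : v = v 4 • w := by rw [hw, smul_smul, mul_inv_cancel₀ h4, one_smul]
    have hw4 : w 4 = 1 := by simp [hw, h4]
    have hwn : w 0 + w 1 * w 5 + w 2 * w 6 = w 3 ^ 2 := by
      simp only [hw, Pi.smul_apply, smul_eq_mul]
      field_simp
      linear_combination hn'
    refine ⟨p5 (-w 2) (w 5 + 2 * w 2 * (-w 3 + w 2 * w 1) - w 2 ^ 2 * w 1) (-w 3 + w 2 * w 1)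
      (-w 6 - (-w 3 + w 2 * w 1) * w 1) (-w 1), v 4, h4, ?_⟩
    rw [hvw]
    congr 1
    · simp [hw4]
    · ext i; fin_cases i <;> simp [hw4, vec] <;> first | ring1 | linear_combination hwn

lemma exists_comb_of_inc {x : Pt K} {m : Ln K} (h : Inc x m) :
    ∃ a b : K, vec x = a • vec (parent m) + b • vec (child m 0) := by
  rcases h with rfl | ⟨c, rfl⟩
  · exact ⟨1, 0, by simp⟩
  · exact ⟨_, _, vec_child m c⟩

lemma inc_of_eq_comb {x : Pt K} {m : Ln K} {a b : K}
    (h : vec x = a • vec (parent m) + b • vec (child m 0)) : Inc x m := by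
  by_cases hb : b = 0
  · exact Or.inl (eq_of_vec_eq_smul (c := a) (by simpa [hb] using h))
  · refine Or.inr ⟨sgn m * (a / b), eq_of_vec_eq_smul (c := b) ?_⟩
    rw [h, vec_child m (sgn m * (a / b)), smul_add, smul_smul, ← mul_assoc (sgn m), sgn_mul_self,
      one_mul, one_smul, mul_div_cancel₀ _ hb]

lemma cross_eq_zero_iff (h2 : (2 : K) ≠ 0) (x y : Fin 7 → K) : cross x y = 0 ↔
    (x 5 * y 6 - x 6 * y 5 = x 0 * y 3 - x 3 * y 0 ∧
    x 4 * y 6 - x 6 * y 4 = -(x 1 * y 3 - x 3 * y 1) ∧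
    x 4 * y 5 - x 5 * y 4 = x 2 * y 3 - x 3 * y 2 ∧
    x 0 * y 4 - x 4 * y 0 + (x 1 * y 5 - x 5 * y 1) + (x 2 * y 6 - x 6 * y 2) = 0 ∧
    x 1 * y 2 - x 2 * y 1 = x 3 * y 4 - x 4 * y 3 ∧
    x 0 * y 2 - x 2 * y 0 = -(x 3 * y 5 - x 5 * y 3) ∧
    x 0 * y 1 - x 1 * y 0 = x 3 * y 6 - x 6 * y 3) := by
  simp only [funext_iff, Fin.forall_fin_succ, cross]
  simp [h2, sub_eq_zero, ← eq_neg_iff_add_eq_zero]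
  intros
  exact eq_comm

lemma comb_of_cross_eq_zero (h2 : (2 : K) ≠ 0) {y : Fin 7 → K} {m : Ln K}
    (hp : cross (vec (parent m)) y = 0) (hc : cross (vec (child m 0)) y = 0) :
    ∃ a b : K, y = a • vec (parent m) + b • vec (child m 0) := by
  rw [cross_eq_zero_iff h2] at hp hc
  obtain ⟨p0, p1, p2, p3, p4, p5, p6⟩ := hp
  obtain ⟨c0, c1, c2, c3, c4, c5, c6⟩ := hc
  cases m
  case l0 =>
    refine ⟨y 0, y 6, ?_⟩
    simp [vec, parent, child] at *
    ext i; fin_cases i <;> simp <;> grind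
  case l1 k =>
    refine ⟨y 0, y 5, ?_⟩
    simp [vec, parent, child] at *
    ext i; fin_cases i <;> simp <;> grind
  case l2 a l =>
    refine ⟨y 6, y 1, ?_⟩
    simp [vec, parent, child] at *
    ext i; fin_cases i <;> simp <;> grind
  case l3 k b k' =>
    refine ⟨y 5, y 2, ?_⟩
    simp [vec, parent, child] at *
    ext i; fin_cases i <;> simp <;> grind
  case l4 a l a' l' =>
    refine ⟨y 1, y 4, ?_⟩
    simp [vec, parent, child] at *
    ext i; fin_cases i <;> simp <;> grind
  case l5 k b k' b' k'' =>
    refine ⟨y 2, y 4, ?_⟩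
    simp [vec, parent, child] at *
    ext i; fin_cases i <;> simp
    · linear_combination -p5 + b' * p2 + b * c2
    · linear_combination -p4
    · linear_combination -p2
    · linear_combination c2
    · linear_combination c1 + b' * p4 - b * p2

lemma exists_comb_lnOf (h2 : (2 : K) ≠ 0) (x : Pt K) {y : Fin 7 → K} (h : cross (vec x) y = 0) :
    ∃ (o : Option K) (a b : K),
      y = a • vec (parent (lnOf x o)) + b • vec (child (lnOf x o) 0) := by
  rw [cross_eq_zero_iff h2] at h
  obtain ⟨h0, h1, h2, h3, h4, h5, h6⟩ := h
  cases x
  case p0 =>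
    by_cases hy : y 5 = 0
    · refine ⟨none, y 0, y 6, ?_⟩
      simp [vec, lnOf, parent, child] at *
      ext i; fin_cases i <;> simp <;> grind
    · refine ⟨some (-(y 6 / y 5)), y 0, y 5, ?_⟩
      simp [vec, lnOf, parent, child] at *
      ext i; fin_cases i <;> simp <;> grind
  case p1 a =>
    by_cases hy : y 1 = 0
    · refine ⟨none, y 0 , y 6, ?_⟩
      simp [vec, lnOf, parent, child] at *
      ext i; fin_cases i <;> simp <;> grind
    · refine ⟨some (-((y 0 - a * y 6) / y 1)), y 6, y 1, ?_⟩
      simp [vec, lnOf, parent, child] at *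
      ext i; fin_cases i <;> simp <;> grind
  case p2 k b =>
    by_cases hy : y 2 = 0
    · refine ⟨none, y 0, y 5, ?_⟩
      simp [vec, lnOf, parent, child] at *
      ext i; fin_cases i <;> simp <;> grind
    · refine ⟨some ((y 0 - b * y 5) / y 2), y 5, y 2, ?_⟩
      simp [vec, lnOf, parent, child] at *
      ext i; fin_cases i <;> simp <;> grind
  case p3 a l a' =>
    by_cases hy : y 4 = 0
    · refine ⟨none, y 6, y 1, ?_⟩
      simp [vec, lnOf, parent, child] at *
      ext i; fin_cases i <;> simp <;> grind
    · refine ⟨some (-((y 6 + a' * y 1) / y 4)), y 1, y 4, ?_⟩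
      simp [vec, lnOf, parent, child] at *
      ext i; fin_cases i <;> simp <;> grind
  case p4 k b k' b' =>
    by_cases hy : y 4 = 0
    · refine ⟨none, y 5, y 2, ?_⟩
      simp [vec, lnOf, parent, child] at *
      ext i; fin_cases i <;> simp <;> grind
    · refine ⟨some ((y 5 - b' * y 2) / y 4), y 2, y 4, ?_⟩
      simp [vec, lnOf, parent, child] at *
      ext i; fin_cases i <;> simp <;> grind
  case p5 a l a' l' a'' =>
    by_cases hy : y 2 + a * y 4 = 0
    · refine ⟨none, y 1, y 4, ?_⟩
      simp [vec, lnOf, parent, child] at *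
      ext i; fin_cases i <;> simp <;> grind
    · obtain ⟨k, hk⟩ : ∃ k, k * (y 2 + a * y 4) = y 1 + a'' * y 4 :=
        ⟨(y 1 + a'' * y 4) / (y 2 + a * y 4), div_mul_cancel₀ _ hy⟩
      refine ⟨some k, y 2, y 4, ?_⟩
      simp [vec, lnOf, parent, child] at *
      have e1 : y 1 = k * (y 2 + a * y 4) - a'' * y 4 := by rw [hk]; ring
      have e3 : y 3 = a'' * y 2 - a * y 1 + (-a' + a * a'') * y 4 := by linear_combination h4
      have e5 : y 5 = (l + 2 * a * a' - a ^ 2 * a'') * y 4 - a * y 3 - (-a' + a * a'') * y 2 := by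
        linear_combination h2
      have e6 : y 6 = (-l' + a' * a'') * y 4 + (-a' + a * a'') * y 1 + a'' * y 3 := by
        linear_combination h1
      clear h0 h1 h2 h4 h5 h6 hk hy
      ext i; fin_cases i <;> simp
      · rw [e5, e6, e3, e1] at h3
        linear_combination -h3
      · rw [e1]; ring
      · rw [e3, e1]; ring
      · rw [e5, e3, e1]; ring
      · rw [e6, e3, e1]; ring

lemma line_unique {x y : Pt K} {m n : Ln K} (hxy : x ≠ y) (hxm : Inc x m) (hym : Inc y m)
    (hxn : Inc x n) (hyn : Inc y n) : m = n := by
  obtain ⟨o, rfl⟩ := exists_lnOf hxm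
  obtain ⟨o', rfl⟩ := exists_lnOf hxn
  clear hxm hxn
  rcases hym with rfl | ⟨c, rfl⟩ <;> rcases hyn with hyn | ⟨c', hyn⟩ <;> revert hxy hyn <;>
    cases x <;> cases o <;> cases o' <;> simp [lnOf, parent, child]
  all_goals grind

/-- The two points are collinear in the hexagon. -/
def Col (x y : Pt K) : Prop := cross (vec x) (vec y) = 0

/-- The two points are not opposite in the hexagon. -/
def Perp (x y : Pt K) : Prop := form (vec x) (vec y) = 0

lemma Col.refl (x : Pt K) : Col x x := cross_self _

lemma Col.symm {x y : Pt K} (h : Col x y) : Col y x := by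
  rw [Col, cross_anti, h, neg_zero]

lemma Perp.symm {x y : Pt K} (h : Perp x y) : Perp y x := by
  rw [Perp, form_comm, h]

lemma cross_zero (x : Fin 7 → K) : cross x 0 = 0 := by
  simpa using cross_smul x 0 (0 : K)

lemma eq_zero_of_inc {V : Type*} [AddCommGroup V] [Module K V] {f : (Fin 7 → K) → V}
    (hf : ∀ y z (a b : K), f (a • y + b • z) = a • f y + b • f z) {x : Pt K} {m : Ln K}
    (h : Inc x m) (hp : f (vec (parent m)) = 0) (hc : f (vec (child m 0)) = 0) :
    f (vec x) = 0 := by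
  obtain ⟨a, b, e⟩ := exists_comb_of_inc h
  rw [e, hf, hp, hc, smul_zero, smul_zero, add_zero]

lemma eq_zero_of_two_inc {V : Type*} [AddCommGroup V] [Module K V] {f : (Fin 7 → K) → V}
    (hf : ∀ y z (a b : K), f (a • y + b • z) = a • f y + b • f z) {x y : Pt K} {m : Ln K}
    (hxy : x ≠ y) (hx : Inc x m) (hy : Inc y m) (hfx : f (vec x) = 0) (hfy : f (vec y) = 0) :
    f (vec (parent m)) = 0 ∧ f (vec (child m 0)) = 0 := by
  have key : f (vec (parent m)) = 0 → ∀ c, f (vec (child m c)) = 0 →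
      f (vec (child m 0)) = 0 := by
    intro h c hc
    rwa [vec_child, hf, h, smul_zero, zero_add, one_smul] at hc
  rcases hx with rfl | ⟨c, rfl⟩ <;> rcases hy with rfl | ⟨c', rfl⟩
  · exact absurd rfl hxy
  · exact ⟨hfx, key hfx _ hfy⟩
  · exact ⟨hfy, key hfy _ hfx⟩
  · have hc : c - c' ≠ 0 := sub_ne_zero.2 fun h => hxy (by rw [h])
    have hs : sgn m ≠ 0 := left_ne_zero_of_mul_eq_one (sgn_mul_self m)
    have hp : f (vec (parent m)) = 0 := by
      rw [vec_child, hf] at hfx hfy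
      have : (sgn m * (c - c')) • f (vec (parent m)) = 0 := by
        rw [mul_sub, sub_smul, sub_eq_zero]
        exact add_right_cancel (hfx.trans hfy.symm)
      exact (smul_eq_zero.1 this).resolve_left (mul_ne_zero hs hc)
    exact ⟨hp, key hp _ hfx⟩

lemma form_comb' (x y z : Fin 7 → K) (a b : K) :
    form x (a • y + b • z) = a • form x y + b • form x z := form_comb ..

lemma Col.of_inc {x y : Pt K} {m : Ln K} (hx : Inc x m) (hy : Inc y m) : Col x y := by
  have h1 : ∀ z : Pt K, z = parent m ∨ z = child m 0 → Col z y := by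
    rintro z (rfl | rfl)
    · exact eq_zero_of_inc (cross_comb _) hy (cross_self _) (cross_parent_child m)
    · exact eq_zero_of_inc (cross_comb _) hy
        (by rw [cross_anti, cross_parent_child, neg_zero]) (cross_self _)
  exact Col.symm
    (eq_zero_of_inc (cross_comb _) hx (h1 _ (.inl rfl)).symm (h1 _ (.inr rfl)).symm)

lemma Col.inc_of_two (h2 : (2 : K) ≠ 0) {x y z : Pt K} {m : Ln K} (hyz : y ≠ z)
    (hy : Inc y m) (hz : Inc z m) (hxy : Col x y) (hxz : Col x z) : Inc x m := by
  obtain ⟨hp, hc⟩ := eq_zero_of_two_inc (cross_comb (vec x)) hyz hy hz hxy hxz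
  obtain ⟨a, b, h⟩ := comb_of_cross_eq_zero (y := vec x) h2
    (by rw [cross_anti, hp, neg_zero]) (by rw [cross_anti, hc, neg_zero])
  exact inc_of_eq_comb h

lemma Perp.of_two {x y z w : Pt K} {m : Ln K} (hyz : y ≠ z) (hy : Inc y m) (hz : Inc z m)
    (hxy : Perp x y) (hxz : Perp x z) (hw : Inc w m) : Perp x w := by
  obtain ⟨hp, hc⟩ := eq_zero_of_two_inc (form_comb' (vec x)) hyz hy hz hxy hxz
  exact eq_zero_of_inc (form_comb' (vec x)) hw hp hc

lemma Col.exists_line (h2 : (2 : K) ≠ 0) {x y : Pt K} (h : Col x y) :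
    ∃ m, Inc x m ∧ Inc y m := by
  obtain ⟨o, a, b, e⟩ := exists_comb_lnOf h2 x h
  exact ⟨_, inc_lnOf x o, inc_of_eq_comb e⟩

lemma Perp.of_col_of_col (h2 : (2 : K) ≠ 0) {x z y : Pt K} (hxz : Col x z) (hzy : Col z y) :
    Perp x y := by
  have h := cross_cross_add (vec x) (vec y) (vec z)
  have self {x z : Pt K} (h : Col x z) : form (vec x) (vec z) = 0 := by
    have e := cross_cross (vec x) (vec z)
    rw [h, vec_null, mul_zero, zero_smul, sub_zero] at e
    rw [cross_zero, eq_comm, smul_eq_zero] at e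
    simpa [h2, vec_ne_zero] using e
  rw [hxz, hzy.symm, cross_zero, cross_zero, self hxz, self hzy.symm] at h
  simp only [mul_zero, zero_smul, add_zero, zero_sub, zero_eq_neg, smul_eq_zero, vec_ne_zero,
    or_false, mul_eq_zero] at h
  refine h.resolve_left fun h4 => h2 ?_
  have : (2 : K) * 2 = 0 := by rw [← h4]; norm_num
  simpa using this

lemma Col.perp (h2 : (2 : K) ≠ 0) {x y : Pt K} (h : Col x y) : Perp x y :=
  .of_col_of_col h2 h (.refl y)

lemma exists_vec_cross (h2 : (2 : K) ≠ 0) {x y : Pt K} (h : Perp x y) (hc : ¬ Col x y) :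
    ∃ (z : Pt K) (c : K), c ≠ 0 ∧ cross (vec x) (vec y) = c • vec z := by
  refine exists_vec_of_null h2 hc ?_
  rw [form_cross_cross, vec_null, h]
  ring

lemma cross_vec_of_eq_smul {v w : Fin 7 → K} {z : Pt K} {c : K} (hc : c ≠ 0)
    (hv : v = c • vec z) (h : cross w v = 0) : cross w (vec z) = 0 := by
  rw [hv, cross_smul, smul_eq_zero] at h
  exact h.resolve_left hc

lemma cross_cross_of_perp {x y : Pt K} (h : Perp x y) :
    cross (vec x) (cross (vec x) (vec y)) = 0 := by
  rw [cross_cross, vec_null, h]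
  simp

lemma cross_neg (x y : Fin 7 → K) : cross x (-y) = -cross x y := by
  simpa using cross_smul x y (-1)

lemma Perp.exists_col (h2 : (2 : K) ≠ 0) {x y : Pt K} (h : Perp x y) :
    ∃ z, Col x z ∧ Col z y := by
  by_cases hc : Col x y
  · exact ⟨y, hc, .refl y⟩
  · obtain ⟨z, c, hc0, e⟩ := exists_vec_cross h2 h hc
    refine ⟨z, cross_vec_of_eq_smul hc0 e (cross_cross_of_perp h), .symm ?_⟩
    refine cross_vec_of_eq_smul hc0 e ?_
    rw [cross_anti (vec x), cross_neg, cross_cross_of_perp h.symm, neg_zero]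

lemma exists_inc_perp (x : Pt K) (m : Ln K) : ∃ y, Inc y m ∧ Perp x y := by
  by_cases h : form (vec x) (vec (parent m)) = 0
  · exact ⟨_, .inl rfl, h⟩
  · refine ⟨_, .inr ⟨-(sgn m * (form (vec x) (vec (child m 0)) / form (vec x) (vec (parent m)))),
      rfl⟩, ?_⟩
    rw [Perp, vec_child, form_comb, mul_neg, ← mul_assoc, sgn_mul_self, one_mul]
    field_simp
    ring

lemma exists_inc_col (h2 : (2 : K) ≠ 0) {x : Pt K} {m : Ln K} (h : ∀ y, Inc y m → Perp x y) :
    ∃ y, Inc y m ∧ Col x y := by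
  by_cases hp : Col x (parent m)
  · exact ⟨_, .inl rfl, hp⟩
  · have hxp := h (parent m) (.inl rfl)
    have hxc := h (child m 0) (.inr ⟨0, rfl⟩)
    obtain ⟨z, c, hc0, e⟩ := exists_vec_cross h2 hxp hp
    have hpc : Col (child m 0) (parent m) := Col.symm (cross_parent_child m)
    refine ⟨z, ?_, cross_vec_of_eq_smul hc0 e (cross_cross_of_perp hxp)⟩
    obtain ⟨a, b, e'⟩ := comb_of_cross_eq_zero (y := vec z) (m := m) h2
      (cross_vec_of_eq_smul hc0 e (by
        rw [cross_anti (vec x), cross_neg, cross_cross_of_perp hxp.symm, neg_zero]))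
      (cross_vec_of_eq_smul hc0 e (by
        have := cross_cross_add (vec (child m 0)) (vec x) (vec (parent m))
        rw [hpc.perp h2, hxp, hxc.symm, hpc] at this
        simpa [cross_zero] using this))
    exact inc_of_eq_comb e'

lemma Col.of_two_middles (h2 : (2 : K) ≠ 0) {a p q z : Pt K} (hpq : p ≠ q) (hap : Col a p)
    (hpz : Col p z) (haq : Col a q) (hqz : Col q z) : Col a z := by
  by_contra hc
  have haz := Perp.of_col_of_col h2 hap hpz
  obtain ⟨w, c, hc0, e⟩ := exists_vec_cross h2 haz hc
  have haw : Col a w := cross_vec_of_eq_smul hc0 e (cross_cross_of_perp haz)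
  have hzw : Col z w := cross_vec_of_eq_smul hc0 e (by
    rw [cross_anti (vec a), cross_neg, cross_cross_of_perp haz.symm, neg_zero])
  have mid {p : Pt K} (hap : Col a p) (hpz : Col p z) : Col p w :=
    cross_vec_of_eq_smul hc0 e (by
      have := cross_cross_add (vec p) (vec a) (vec z)
      rw [hpz, hpz.perp h2, haz, hap.symm.perp h2] at this
      simpa [cross_zero] using this)
  have haw' : a ≠ w := by
    rintro rfl
    exact hc hzw.symm
  obtain ⟨m, ham, hwm⟩ := haw.exists_line h2
  have hpm := hap.symm.inc_of_two h2 haw' ham hwm (mid hap hpz)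
  have hqm := haq.symm.inc_of_two h2 haw' ham hwm (mid haq hqz)
  exact hc (.of_inc ham (hpz.symm.inc_of_two h2 hpq hpm hqm hqz.symm))

end

open Pt Ln

instance : Fact (Nat.Prime 11) := ⟨by norm_num⟩

/-- The field of order 11. -/
abbrev K₁₁ := ZMod 11

lemma two_ne_zero_K : (2 : K₁₁) ≠ 0 := by decide

lemma eq_zero_of_sq_add_sq : ∀ x y : K₁₁, x ^ 2 + y ^ 2 = 0 → x = 0 ∧ y = 0 := by decide

/-- The lines of the last cell among which the spread is chosen. -/
def spreadLine (u v w : K₁₁) : Ln K₁₁ := l5 (-u) v w u v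

lemma vec_parent_spreadLine (u v w : K₁₁) :
    vec (parent (spreadLine u v w)) = ![w + u * v, -u, 1, v, 0, u, u ^ 2 + v ^ 2] := by
  ext i; fin_cases i <;> simp [spreadLine, parent, vec] <;> ring

lemma vec_child_spreadLine (u v w : K₁₁) :
    vec (child (spreadLine u v w) 0) = ![u ^ 2 + v ^ 2, -v, 0, -u, 1, v, -w - u * v] := by
  ext i; fin_cases i <;> simp [spreadLine, child, vec] <;> ring

lemma spreadLine_injective {u v w u' v' w' : K₁₁} {p q : Pt K₁₁} (hp : Inc p (spreadLine u v w))
    (hq : Inc q (spreadLine u' v' w')) (h : Col p q) : u = u' ∧ v = v' ∧ w = w' := by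
  have h1 : Perp p (parent (spreadLine u' v' w')) :=
    .of_col_of_col two_ne_zero_K h (.of_inc hq (.inl rfl))
  have h2 : Perp p (child (spreadLine u' v' w') 0) :=
    .of_col_of_col two_ne_zero_K h (.of_inc hq (.inr ⟨0, rfl⟩))
  obtain ⟨a, b, e⟩ := exists_comb_of_inc hp
  obtain ⟨D, hD⟩ : ∃ D, D = (u - u') ^ 2 + (v - v') ^ 2 := ⟨_, rfl⟩
  obtain ⟨E, hE⟩ : ∃ E, E = w - w' + u * v - u' * v' - 2 * u * v' + 2 * v * u' := ⟨_, rfl⟩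
  have h1' : a * D - b * E = 0 := by
    rw [← h1, form_comm, e, form_comb, vec_parent_spreadLine, vec_child_spreadLine,
      vec_parent_spreadLine, hD, hE]
    simp [form]
    ring
  have h2' : a * E + b * D = 0 := by
    rw [← h2, form_comm, e, form_comb, vec_parent_spreadLine, vec_child_spreadLine,
      vec_child_spreadLine, hD, hE]
    simp [form]
    ring
  have ha : a * (D ^ 2 + E ^ 2) = 0 := by linear_combination D * h1' + E * h2'
  have hb : b * (D ^ 2 + E ^ 2) = 0 := by linear_combination D * h2' - E * h1'
  have hDE : D ^ 2 + E ^ 2 = 0 := by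
    by_contra hne
    apply vec_ne_zero p
    rw [e, (mul_eq_zero.1 ha).resolve_right hne, (mul_eq_zero.1 hb).resolve_right hne]
    simp
  obtain ⟨hD0, hE0⟩ := eq_zero_of_sq_add_sq _ _ hDE
  obtain ⟨hu, hv⟩ := eq_zero_of_sq_add_sq _ _ (hD.symm.trans hD0)
  obtain rfl := sub_eq_zero.1 hu
  obtain rfl := sub_eq_zero.1 hv
  refine ⟨rfl, rfl, sub_eq_zero.1 ?_⟩
  rw [← hE0, hE]
  ring

/-- 300 pairwise opposite lines of the Hermitian spread. -/
def spread (n : ZMod 300) : Ln K₁₁ :=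
  spreadLine (n.val / 100 : ℕ) (n.val / 10 % 10 : ℕ) (n.val % 10 : ℕ)

lemma val_natCast {k : ℕ} (h : k < 11) : (k : K₁₁).val = k := ZMod.val_cast_of_lt h

lemma eq_of_col {n m : ZMod 300} {p q : Pt K₁₁} (hp : Inc p (spread n)) (hq : Inc q (spread m))
    (h : Col p q) : n = m := by
  obtain ⟨hu, hv, hw⟩ := spreadLine_injective hp hq h
  have hn := ZMod.val_lt n
  have hm := ZMod.val_lt m
  apply_fun ZMod.val at hu hv hw
  rw [val_natCast (by omega), val_natCast (by omega)] at hu hv hw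
  exact ZMod.val_injective _ (by omega)

lemma eq_zero_of_three_roots {a b c x y z : K₁₁} (hxy : x ≠ y) (hxz : x ≠ z) (hyz : y ≠ z)
    (hx : a * x ^ 2 + b * x + c = 0) (hy : a * y ^ 2 + b * y + c = 0)
    (hz : a * z ^ 2 + b * z + c = 0) : a = 0 := by
  have h1 : a * (x + y) + b = 0 := mul_left_cancel₀ (sub_ne_zero.2 hxy) (by
    linear_combination hx - hy)
  have h2 : a * (x + z) + b = 0 := mul_left_cancel₀ (sub_ne_zero.2 hxz) (by
    linear_combination hx - hz)
  exact mul_right_cancel₀ (sub_ne_zero.2 hyz) (by linear_combination h1 - h2)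

lemma not_perp_spread (a : Pt K₁₁) {f : Option K₁₁ → ZMod 300} (hf : Function.Injective f)
    (h : ∀ o x, Inc x (spread (f o)) → Perp a x) : False := by
  obtain ⟨u, v, w, hu, hv, hw⟩ : ∃ u v w : Option K₁₁ → K₁₁,
      (∀ o, u o = ((f o).val / 100 : ℕ)) ∧ (∀ o, v o = ((f o).val / 10 % 10 : ℕ)) ∧
      (∀ o, w o = ((f o).val % 10 : ℕ)) := ⟨_, _, _, fun _ => rfl, fun _ => rfl, fun _ => rfl⟩
  have hs (o) : spread (f o) = spreadLine (u o) (v o) (w o) := by rw [hu, hv, hw, spread]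
  have inj {o o'} (h1 : u o = u o') (h2 : v o = v o') (h3 : w o = w o') : o = o' := by
    refine hf (eq_of_col (p := parent (spread (f o))) (q := parent (spread (f o)))
      (.inl rfl) ?_ (.refl _))
    rw [hs, hs, h1, h2, h3]
    exact .inl rfl
  have e1 (o) : vec a 4 * (w o + u o * v o) - vec a 5 * u o + vec a 6 - 2 * vec a 3 * v o
      + vec a 1 * u o + vec a 2 * (u o ^ 2 + v o ^ 2) = 0 := by
    have := h o _ (.inl rfl)
    rw [Perp, hs, vec_parent_spreadLine] at this
    simp [form] at this
    linear_combination this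
  have e2 (o) : vec a 4 * (u o ^ 2 + v o ^ 2) - vec a 5 * v o + 2 * vec a 3 * u o + vec a 0
      + vec a 1 * v o - vec a 2 * (w o + u o * v o) = 0 := by
    have := h o _ (.inr ⟨0, rfl⟩)
    rw [Perp, hs, vec_child_spreadLine] at this
    simp [form] at this
    linear_combination this
  have hnull := vec_null a
  have hne := vec_ne_zero a
  generalize vec a = y at e1 e2 hnull hne
  by_cases h42 : y 4 ^ 2 + y 2 ^ 2 = 0
  · obtain ⟨h4, h2⟩ := eq_zero_of_sq_add_sq _ _ h42
    simp only [h4, h2, zero_mul, add_zero, sub_zero, zero_sub] at e1 e2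
    by_cases h13 : (y 1 - y 5) ^ 2 + (2 * y 3) ^ 2 = 0
    · obtain ⟨h1, h3⟩ := eq_zero_of_sq_add_sq _ _ h13
      have h3' : y 3 = 0 := (mul_eq_zero.1 h3).resolve_left two_ne_zero_K
      have h6 : y 6 = 0 := by linear_combination e1 none - u none * h1 + v none * h3
      have h0 : y 0 = 0 := by linear_combination e2 none - v none * h1 - u none * h3
      have h15 : y 1 = y 5 := sub_eq_zero.1 h1
      have h5 : y 5 = 0 := by
        simp only [form, h4, h2, h3', h6, h0, h15] at hnull
        have : 2 * (y 5 * y 5) = 0 := by linear_combination hnull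
        simpa [two_ne_zero_K] using this
      apply hne
      ext i; fin_cases i <;> simp [*]
    · have key (o o') : u o = u o' ∧ v o = v o' := by
        constructor
        · apply mul_left_cancel₀ h13
          linear_combination (y 1 - y 5) * (e1 o - e1 o') + 2 * y 3 * (e2 o - e2 o')
        · apply mul_left_cancel₀ h13
          linear_combination (y 1 - y 5) * (e2 o - e2 o') - 2 * y 3 * (e1 o - e1 o')
      have : Function.Injective w := fun o o' hw => inj (key o o').1 (key o o').2 hw
      simpa using Fintype.card_le_of_injective w this
  · have injw {o o'} (h1 : u o = u o') (h2 : v o = v o') : o = o' := by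
      refine inj h1 h2 (mul_left_cancel₀ h42 ?_)
      have a1 := e1 o
      have a2 := e2 o
      rw [h1, h2] at a1 a2
      linear_combination y 4 * (a1 - e1 o') - y 2 * (a2 - e2 o')
    have hu3 (o) : u o ∈ ({0, 1, 2} : Finset K₁₁) := by
      have := ZMod.val_lt (f o)
      have : (f o).val / 100 = 0 ∨ (f o).val / 100 = 1 ∨ (f o).val / 100 = 2 := by omega
      rw [hu]
      rcases this with h | h | h <;> rw [h] <;> decide
    obtain ⟨t, -, ht⟩ := Finset.exists_lt_card_fiber_of_mul_lt_card_of_maps_to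
      (s := Finset.univ) (f := u) (t := {0, 1, 2}) (n := 2) (fun o _ => hu3 o) (by simp; decide)
    obtain ⟨o, o', o'', ho, ho', ho'', h1, h2, h3⟩ := Finset.two_lt_card_iff.1 ht
    simp only [Finset.mem_filter, Finset.mem_univ, true_and] at ho ho' ho''
    refine h42 (eq_zero_of_three_roots (x := v o) (y := v o') (z := v o'')
      (b := - 2 * y 3 * y 2 - y 4 * y 5 + y 4 * y 1)
      (c := (y 4 ^ 2 + y 2 ^ 2) * t ^ 2 - y 2 * y 5 * t + y 2 * y 6 + y 2 * y 1 * t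
        + y 4 * (2 * y 3 * t + y 0))
      (fun h => h1 (injw (ho.trans ho'.symm) h)) (fun h => h2 (injw (ho.trans ho''.symm) h))
      (fun h => h3 (injw (ho'.trans ho''.symm) h)) ?_ ?_ ?_)
    · rw [← ho]
      linear_combination y 2 * e1 o + y 4 * e2 o
    · rw [← ho']
      linear_combination y 2 * e1 o' + y 4 * e2 o'
    · rw [← ho'']
      linear_combination y 2 * e1 o'' + y 4 * e2 o''

/-- The fixed-point free involution pairing up the six copies of a replaced line. -/
def mate : Fin 6 → Fin 6 := ![1, 0, 3, 2, 5, 4]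

/-- The displacements of the edges joining copies of `K₆`. -/
def jump : Fin 6 → Fin 5 → ZMod 300 :=
  ![![91, 111, 55, 110, 119], ![209, 189, 245, 190, 181],
    ![10, 2, 127, 3, 130], ![290, 298, 173, 297, 170],
    ![148, 37, 104, 141, 86], ![152, 263, 196, 159, 214]]

/-- The natural numbers below 300 that are zero or represent a displacement. -/
def jumpVal : List ℕ :=
  [0, 91, 111, 55, 110, 119, 209, 189, 245, 190, 181, 10, 2, 127, 3, 130, 290, 298, 173, 297, 170,
    148, 37, 104, 141, 86, 152, 263, 196, 159, 214]

lemma mate_mate : ∀ i, mate (mate i) = i := by decide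

lemma mate_ne : ∀ i, mate i ≠ i := by decide

lemma jump_mate : ∀ i r, jump (mate i) r = -jump i r := by decide

set_option maxRecDepth 100000 in
lemma exists_jumpVal : ∀ d < 300, ∃ x ∈ jumpVal, ∃ y ∈ jumpVal, (x + y) % 300 = d := by
  decide +kernel

lemma exists_jump : ∀ x ∈ jumpVal, x = 0 ∨ ∃ i r, jump i r = (x : ZMod 300) := by
  decide +kernel

/-- A label for the points of the replaced lines, taking each of the six values twice on a line. -/
def door : Pt K₁₁ → Fin 6
  | p5 a _ _ _ _ => Fin.ofNat 6 (a.val / 2)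
  | _ => 5

/-- The parameters of the two points of a replaced line with label `i`. -/
def doorIndex (i : Fin 6) : Bool → Option K₁₁
  | false => some ((2 * i.val : ℕ) : K₁₁)
  | true => if i = 5 then none else some ((2 * i.val + 1 : ℕ) : K₁₁)

/-- The two points of a replaced line with label `i`. -/
def doorPt (n : ZMod 300) (i : Fin 6) (b : Bool) : Pt K₁₁ := ptOf (spread n) (doorIndex i b)

lemma door_ptOf (n : ZMod 300) (o : Option K₁₁) : door (ptOf (spread n) o) =
    o.elim 5 fun a => Fin.ofNat 6 (a.val / 2) := by
  cases o <;> rfl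

lemma doorIndex_injective (i : Fin 6) : Function.Injective (doorIndex i) := by
  revert i; decide

lemma exists_doorIndex : ∀ o : Option K₁₁,
    ∃ b, doorIndex (o.elim 5 fun a => Fin.ofNat 6 (a.val / 2)) b = o := by
  decide

lemma elim_doorIndex : ∀ i b,
    ((doorIndex i b).elim 5 fun a => Fin.ofNat 6 (a.val / 2)) = i := by
  decide

lemma inc_doorPt (n : ZMod 300) (i : Fin 6) (b : Bool) : Inc (doorPt n i b) (spread n) :=
  inc_ptOf _ _

lemma door_doorPt (n : ZMod 300) (i : Fin 6) (b : Bool) : door (doorPt n i b) = i := by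
  rw [doorPt, door_ptOf, elim_doorIndex]

lemma doorPt_ne (n : ZMod 300) (i : Fin 6) : doorPt n i false ≠ doorPt n i true := fun h =>
  Bool.false_ne_true (doorIndex_injective i (ptOf_injective _ h))

lemma exists_doorPt {x : Pt K₁₁} {n : ZMod 300} (h : Inc x (spread n)) :
    ∃ b, doorPt n (door x) b = x := by
  obtain ⟨o, rfl⟩ := exists_ptOf h
  obtain ⟨b, hb⟩ := exists_doorIndex o
  exact ⟨b, by rw [doorPt, door_ptOf, hb]⟩

lemma spread_injective : Function.Injective spread := fun n m h =>
  eq_of_col (p := parent (spread n)) (.inl rfl) (by rw [h]; exact .inl rfl) (.refl _)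

/-- The vertices of the hexagon graph after replacing each line `spread n` by a copy of `K₆`. -/
inductive Vtx
  | pt (x : Pt K₁₁)
  | ln (m : Ln K₁₁) (h : m ∉ Set.range spread)
  | cp (n : ZMod 300) (i : Fin 6)

open Vtx

/-- Adjacency in the modified hexagon graph. -/
def adj : Vtx → Vtx → Prop
  | pt x, ln m _ => Inc x m
  | ln m _, pt x => Inc x m
  | pt x, cp n i => Inc x (spread n) ∧ door x = i
  | cp n i, pt x => Inc x (spread n) ∧ door x = i
  | cp n i, cp m j => n = m ∧ i ≠ j ∨ j = mate i ∧ ∃ r, m = n + jump i r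
  | _, _ => False

/-- The modified hexagon graph. -/
def graph : SimpleGraph Vtx where
  Adj := adj
  symm := ⟨by
    rintro (x | ⟨m, hm⟩ | ⟨n, i⟩) (y | ⟨m', hm'⟩ | ⟨n', j⟩) h <;> try exact h
    rcases h with ⟨rfl, h⟩ | ⟨rfl, r, rfl⟩
    · exact .inl ⟨rfl, h.symm⟩
    · exact .inr ⟨(mate_mate i).symm, r, by rw [jump_mate, add_neg_cancel_right]⟩⟩
  loopless := ⟨by
    rintro (x | ⟨m, hm⟩ | ⟨n, i⟩) h
    · exact h
    · exact h
    · rcases h with ⟨-, h⟩ | ⟨h, -⟩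
      · exact h rfl
      · exact mate_ne i h.symm⟩

/-- The points as a sum of affine spaces. -/
def ptEquiv : Pt K₁₁ ≃ Unit ⊕ K₁₁ ⊕ (K₁₁ × K₁₁) ⊕ (K₁₁ × K₁₁ × K₁₁) ⊕
    (K₁₁ × K₁₁ × K₁₁ × K₁₁) ⊕ (K₁₁ × K₁₁ × K₁₁ × K₁₁ × K₁₁) where
  toFun
    | p0 => .inl ()
    | p1 a => .inr (.inl a)
    | p2 a b => .inr (.inr (.inl (a, b)))
    | p3 a b c => .inr (.inr (.inr (.inl (a, b, c))))
    | p4 a b c d => .inr (.inr (.inr (.inr (.inl (a, b, c, d)))))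
    | p5 a b c d e => .inr (.inr (.inr (.inr (.inr (a, b, c, d, e)))))
  invFun
    | .inl () => p0
    | .inr (.inl a) => p1 a
    | .inr (.inr (.inl (a, b))) => p2 a b
    | .inr (.inr (.inr (.inl (a, b, c)))) => p3 a b c
    | .inr (.inr (.inr (.inr (.inl (a, b, c, d))))) => p4 a b c d
    | .inr (.inr (.inr (.inr (.inr (a, b, c, d, e))))) => p5 a b c d e
  left_inv x := by cases x <;> rfl
  right_inv x := by rcases x with _ | _ | _ | _ | _ | _ <;> rfl

/-- Points and lines are equinumerous cell by cell. -/
def ptEquivLn : Pt K₁₁ ≃ Ln K₁₁ where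
  toFun
    | p0 => l0
    | p1 a => l1 a
    | p2 a b => l2 a b
    | p3 a b c => l3 a b c
    | p4 a b c d => l4 a b c d
    | p5 a b c d e => l5 a b c d e
  invFun
    | l0 => p0
    | l1 a => p1 a
    | l2 a b => p2 a b
    | l3 a b c => p3 a b c
    | l4 a b c d => p4 a b c d
    | l5 a b c d e => p5 a b c d e
  left_inv x := by cases x <;> rfl
  right_inv x := by cases x <;> rfl

noncomputable instance : Fintype (Pt K₁₁) := Fintype.ofEquiv _ ptEquiv.symm

noncomputable instance : Fintype (Ln K₁₁) := Fintype.ofEquiv _ ptEquivLn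

lemma card_pt : Nat.card (Pt K₁₁) = 177156 := by
  rw [Nat.card_congr ptEquiv, Nat.card_eq_fintype_card]
  simp

lemma card_ln : Nat.card (Ln K₁₁) = 177156 := by
  rw [← Nat.card_congr ptEquivLn, card_pt]

/-- The vertices as a sum of points, remaining lines and copies. -/
def vtxEquiv : Vtx ≃ Pt K₁₁ ⊕ ((Set.range spread)ᶜ : Set (Ln K₁₁)) ⊕ (ZMod 300 × Fin 6) where
  toFun
    | pt x => .inl x
    | ln m h => .inr (.inl ⟨m, h⟩)
    | cp n i => .inr (.inr (n, i))
  invFun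
    | .inl x => pt x
    | .inr (.inl m) => ln m.1 m.2
    | .inr (.inr (n, i)) => cp n i
  left_inv x := by cases x <;> rfl
  right_inv x := by rcases x with _ | _ | _ <;> rfl

lemma card_vtx : Nat.card Vtx = 355812 := by
  have h := Set.ncard_add_ncard_compl (Set.range spread)
  rw [card_ln, Set.ncard_range_of_injective spread_injective, Nat.card_zmod] at h
  rw [Nat.card_congr vtxEquiv, Nat.card_sum, Nat.card_sum, Nat.card_prod, card_pt,
    Nat.card_coe_set_eq, Nat.card_zmod, Nat.card_fin]
  generalize (Set.range spread)ᶜ.ncard = k at *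
  lia

lemma ncard_le_of_subset_range {α β : Type*} [Finite β] {s : Set α} (f : β → α)
    (h : s ⊆ Set.range f) : s.ncard ≤ Nat.card β := by
  refine (Set.ncard_le_ncard h (Set.finite_range f)).trans ?_
  rw [← Set.image_univ, ← Set.ncard_univ]
  exact Set.ncard_image_le

open Classical in
/-- The neighbour of the point `x` arising from the line `m`. -/
noncomputable def nodeAt (x : Pt K₁₁) (m : Ln K₁₁) : Vtx :=
  if h : ∃ n, spread n = m then cp h.choose (door x) else ln m h

lemma nodeAt_spread (x : Pt K₁₁) (n : ZMod 300) : nodeAt x (spread n) = cp n (door x) := by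
  have h : ∃ k, spread k = spread n := ⟨n, rfl⟩
  rw [nodeAt, dif_pos h, spread_injective h.choose_spec]

lemma nodeAt_of_notMem (x : Pt K₁₁) {m : Ln K₁₁} (h : m ∉ Set.range spread) : nodeAt x m = ln m h :=
  dif_neg h

lemma ncard_neighborSet_le (v : Vtx) : (graph.neighborSet v).ncard ≤ 12 := by
  rcases v with x | ⟨m, hm⟩ | ⟨n, i⟩
  · refine (ncard_le_of_subset_range (fun o => nodeAt x (lnOf x o)) ?_).trans_eq
      (b := Nat.card (Option K₁₁)) (by simp)
    rintro (y | ⟨m, hm⟩ | ⟨n, i⟩) h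
    · exact h.elim
    · obtain ⟨o, rfl⟩ := exists_lnOf h
      exact ⟨o, nodeAt_of_notMem x hm⟩
    · obtain ⟨h, rfl⟩ := h
      obtain ⟨o, ho⟩ := exists_lnOf h
      exact ⟨o, by simp only [ho, nodeAt_spread]⟩
  · refine (ncard_le_of_subset_range (fun o => pt (ptOf m o)) ?_).trans_eq
      (b := Nat.card (Option K₁₁)) (by simp)
    rintro (y | ⟨m, hm⟩ | ⟨n, i⟩) h
    · obtain ⟨o, rfl⟩ := exists_ptOf h
      exact ⟨o, rfl⟩
    · exact h.elim
    · exact h.elim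
  · refine (ncard_le_of_subset_range (β := Fin 5 ⊕ Fin 5 ⊕ Bool)
      (Sum.elim (fun r => cp n (i.succAbove r)) (Sum.elim (fun r => cp (n + jump i r) (mate i))
        fun b => pt (doorPt n i b))) ?_).trans_eq (by simp)
    rintro (y | ⟨m, hm⟩ | ⟨m, j⟩) h
    · obtain ⟨h, rfl⟩ := h
      obtain ⟨b, hb⟩ := exists_doorPt h
      exact ⟨.inr (.inr b), by simp [hb]⟩
    · exact h.elim
    · rcases h with ⟨rfl, h⟩ | ⟨rfl, r, rfl⟩
      · obtain ⟨r, rfl⟩ := Fin.exists_succAbove_eq h.symm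
        exact ⟨.inl r, rfl⟩
      · exact ⟨.inr (.inl r), rfl⟩

/-- The vertices are joined by a walk of length at most `d`. -/
def Within (d : ℕ) (u v : Vtx) : Prop := ∃ w : graph.Walk u v, w.length ≤ d

lemma Within.refl (u : Vtx) : Within 0 u u := ⟨.nil, le_rfl⟩

lemma Within.symm {d : ℕ} {u v : Vtx} (h : Within d u v) : Within d v u := by
  obtain ⟨w, hw⟩ := h
  exact ⟨w.reverse, by rwa [SimpleGraph.Walk.length_reverse]⟩

lemma Within.mono {d e : ℕ} {u v : Vtx} (h : Within d u v) (hde : d ≤ e) : Within e u v := by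
  obtain ⟨w, hw⟩ := h
  exact ⟨w, hw.trans hde⟩

lemma Within.trans {d e : ℕ} {u v t : Vtx} (h : Within d u v) (h' : Within e v t) :
    Within (d + e) u t := by
  obtain ⟨w, hw⟩ := h
  obtain ⟨w', hw'⟩ := h'
  exact ⟨w.append w', by rw [SimpleGraph.Walk.length_append]; omega⟩

lemma Within.of_adj {u v : Vtx} (h : graph.Adj u v) : Within 1 u v := ⟨.cons h .nil, le_rfl⟩

lemma within_pt_ln {x : Pt K₁₁} {m : Ln K₁₁} {h : m ∉ Set.range spread} (hx : Inc x m) :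
    Within 1 (pt x) (ln m h) := .of_adj hx

lemma within_pt_cp_door {x : Pt K₁₁} {n : ZMod 300} (hx : Inc x (spread n)) :
    Within 1 (pt x) (cp n (door x)) := .of_adj ⟨hx, rfl⟩

lemma within_cp_cp_same (n : ZMod 300) (i j : Fin 6) : Within 1 (cp n i) (cp n j) := by
  by_cases h : i = j
  · subst h
    exact (Within.refl _).mono zero_le_one
  · exact .of_adj (Or.inl ⟨rfl, h⟩)

lemma within_pt_cp {x : Pt K₁₁} {n : ZMod 300} (hx : Inc x (spread n)) (i : Fin 6) :
    Within 2 (pt x) (cp n i) :=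
  (within_pt_cp_door hx).trans (within_cp_cp_same ..)

lemma within_of_inc {x y : Pt K₁₁} {m : Ln K₁₁} (h : m ∉ Set.range spread) (hx : Inc x m)
    (hy : Inc y m) : Within 2 (pt x) (pt y) :=
  (within_pt_ln (h := h) hx).trans (within_pt_ln hy).symm

lemma within_of_inc_inc {x y : Pt K₁₁} {m : Ln K₁₁} (hx : Inc x m) (hy : Inc y m) :
    Within 3 (pt x) (pt y) := by
  by_cases h : m ∈ Set.range spread
  · obtain ⟨n, rfl⟩ := h
    exact (within_pt_cp hx _).trans (within_pt_cp_door hy).symm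
  · exact (within_of_inc h hx hy).mono (by norm_num)

lemma Col.within {x y : Pt K₁₁} (h : Col x y) : Within 3 (pt x) (pt y) := by
  obtain ⟨m, hx, hy⟩ := h.exists_line two_ne_zero_K
  exact within_of_inc_inc hx hy

lemma Perp.exists_path {x y : Pt K₁₁} (h : Perp x y) :
    ∃ z m l, Inc x m ∧ Inc z m ∧ Inc z l ∧ Inc y l := by
  obtain ⟨z, hxz, hzy⟩ := h.exists_col two_ne_zero_K
  obtain ⟨m, hxm, hzm⟩ := hxz.exists_line two_ne_zero_K
  obtain ⟨l, hzl, hyl⟩ := hzy.exists_line two_ne_zero_K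
  exact ⟨z, m, l, hxm, hzm, hzl, hyl⟩

lemma Perp.within {x y : Pt K₁₁} (h : Perp x y) : Within 5 (pt x) (pt y) := by
  obtain ⟨z, m, l, hxm, hzm, hzl, hyl⟩ := h.exists_path
  by_cases hm : m ∈ Set.range spread
  · by_cases hl : l ∈ Set.range spread
    · obtain ⟨n, rfl⟩ := hm
      obtain ⟨k, rfl⟩ := hl
      obtain rfl := eq_of_col hzm hzl (.refl z)
      exact (within_of_inc_inc hxm hyl).mono (by norm_num)
    · exact (within_of_inc_inc hxm hzm).trans (within_of_inc hl hzl hyl)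
  · exact (within_of_inc hm hxm hzm).trans (within_of_inc_inc hzl hyl)

lemma within_pt_ln_six (x : Pt K₁₁) (m : Ln K₁₁) (h : m ∉ Set.range spread) :
    Within 6 (pt x) (ln m h) := by
  obtain ⟨y, hy, hxy⟩ := exists_inc_perp x m
  exact hxy.within.trans (within_pt_ln hy)

lemma within_pt_cp_six (x : Pt K₁₁) (n : ZMod 300) (i : Fin 6) : Within 6 (pt x) (cp n i) := by
  obtain ⟨y, hy, hxy⟩ := exists_inc_perp x (spread n)
  obtain ⟨z, m, l, hxm, hzm, hzl, hyl⟩ := hxy.exists_path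
  by_cases hm : m ∈ Set.range spread
  · obtain ⟨k, rfl⟩ := hm
    obtain rfl := eq_of_col hzm hy (.of_inc hzl hyl)
    exact (within_pt_cp hxm i).mono (by norm_num)
  · by_cases hl : l ∈ Set.range spread
    · obtain ⟨k, rfl⟩ := hl
      obtain rfl := eq_of_col hyl hy (.refl y)
      exact ((within_of_inc hm hxm hzm).trans (within_pt_cp hzl i)).mono (by norm_num)
    · exact ((within_of_inc hm hxm hzm).trans (within_of_inc hl hzl hyl)).trans (within_pt_cp hy i)

lemma within_cp_jump {x : ℕ} (hx : x ∈ jumpVal) (n : ZMod 300) (i : Fin 6) :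
    ∃ j, Within 2 (cp n i) (cp (n + x) j) := by
  rcases exists_jump x hx with rfl | ⟨k, r, h⟩
  · refine ⟨i, ?_⟩
    rw [Nat.cast_zero, add_zero]
    exact (Within.refl _).mono (by norm_num)
  · have hadj : graph.Adj (cp n k) (cp (n + x) (mate k)) := Or.inr ⟨rfl, r, by rw [h]⟩
    exact ⟨mate k, (within_cp_cp_same n i k).trans (.of_adj hadj)⟩

lemma within_cp_cp (n m : ZMod 300) (i j : Fin 6) : Within 5 (cp n i) (cp m j) := by
  obtain ⟨x, hx, y, hy, h⟩ := exists_jumpVal _ (ZMod.val_lt (m - n))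
  obtain ⟨k, hk⟩ := within_cp_jump hx n i
  obtain ⟨k', hk'⟩ := within_cp_jump hy (n + x) k
  have e : n + x + y = m := by
    rw [add_assoc, ← Nat.cast_add, ← ZMod.natCast_mod (x + y) 300, h, ZMod.natCast_val,
      ZMod.cast_id, add_sub_cancel]
  rw [e] at hk'
  exact (hk.trans hk').trans (within_cp_cp_same m k' j)

/-- The point lies on one of the replaced lines. -/
def OnSpread (x : Pt K₁₁) : Prop := ∃ n, Inc x (spread n)

lemma notMem_range_of_inc {x : Pt K₁₁} {m : Ln K₁₁} (hx : Inc x m) (h : ¬ OnSpread x) :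
    m ∉ Set.range spread := by
  rintro ⟨n, rfl⟩
  exact h ⟨n, hx⟩

lemma eq_of_onSpread {m : Ln K₁₁} (hm : m ∉ Set.range spread) {x y : Pt K₁₁} (hx : Inc x m)
    (hy : Inc y m) (h : OnSpread x) (h' : OnSpread y) : x = y := by
  obtain ⟨n, hn⟩ := h
  obtain ⟨k, hk⟩ := h'
  obtain rfl := eq_of_col hn hk (.of_inc hx hy)
  by_contra hxy
  exact hm ⟨n, line_unique hxy hn hk hx hy⟩

lemma exists_inc_not_not {m : Ln K₁₁} {P Q : Pt K₁₁ → Prop}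
    (hP : ∀ x y, Inc x m → Inc y m → P x → P y → x = y)
    (hQ : ∀ x y, Inc x m → Inc y m → Q x → Q y → x = y) :
    ∃ x, Inc x m ∧ ¬ P x ∧ ¬ Q x := by
  by_contra! h
  have inj := ptOf_injective m
  have h01 : ptOf m none ≠ ptOf m (some 0) := inj.ne (by simp)
  have h02 : ptOf m none ≠ ptOf m (some 1) := inj.ne (by simp)
  have h12 : ptOf m (some 0) ≠ ptOf m (some 1) := inj.ne (by simp)
  have i (o) := inc_ptOf m o
  have f01 := fun h h' => h01 (hP _ _ (i _) (i _) h h')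
  have f02 := fun h h' => h02 (hP _ _ (i _) (i _) h h')
  have f12 := fun h h' => h12 (hP _ _ (i _) (i _) h h')
  have g01 := fun h h' => h01 (hQ _ _ (i _) (i _) h h')
  have g02 := fun h h' => h02 (hQ _ _ (i _) (i _) h h')
  have g12 := fun h h' => h12 (hQ _ _ (i _) (i _) h h')
  have h0 := h _ (i none)
  have h1 := h _ (i (some 0))
  have h2 := h _ (i (some 1))
  tauto

lemma within_ln_ln_of_perp {a b : Ln K₁₁} {ha : a ∉ Set.range spread}
    {hb : b ∉ Set.range spread} {p q : Pt K₁₁} (hp : Inc p a) (hq : Inc q b) (hpS : ¬ OnSpread p)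
    (hqS : ¬ OnSpread q) (h : Perp p q) : Within 6 (ln a ha) (ln b hb) := by
  obtain ⟨z, m, l, hpm, hzm, hzl, hql⟩ := h.exists_path
  exact (((within_pt_ln hp).symm.trans (within_of_inc (notMem_range_of_inc hpm hpS) hpm hzm)).trans
    (within_of_inc (notMem_range_of_inc hql hqS) hzl hql)).trans (within_pt_ln hq)

lemma within_ln_ln (a b : Ln K₁₁) (ha : a ∉ Set.range spread) (hb : b ∉ Set.range spread) :
    Within 6 (ln a ha) (ln b hb) := by
  by_cases h : ∃ q, Inc q b ∧ OnSpread q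
  · obtain ⟨q, hqb, hq⟩ := h
    by_cases h2 : ∀ x y, Inc x a → Inc y a → Perp q x → Perp q y → x = y
    · obtain ⟨p, hpa, hpS, hqp⟩ := exists_inc_not_not (fun x y hx hy => eq_of_onSpread ha hx hy) h2
      obtain ⟨r, hrb, hpr⟩ := exists_inc_perp p b
      refine within_ln_ln_of_perp hpa hrb hpS (fun hr => hqp ?_) hpr
      rw [eq_of_onSpread hb hqb hrb hq hr]
      exact hpr.symm
    · push Not at h2
      obtain ⟨x, y, hx, hy, hqx, hqy, hxy⟩ := h2
      obtain ⟨u, hua, hqu⟩ := exists_inc_col two_ne_zero_K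
        fun w hw => Perp.of_two hxy hx hy hqx hqy hw
      exact (((within_pt_ln hua).symm.trans hqu.symm.within).trans (within_pt_ln hqb)).mono
        (by norm_num)
  · push Not at h
    obtain ⟨p, hpa, hpS, -⟩ := exists_inc_not_not (Q := fun _ => False)
      (fun x y hx hy => eq_of_onSpread ha hx hy) (fun _ _ _ _ h => h.elim)
    obtain ⟨r, hrb, hpr⟩ := exists_inc_perp p b
    exact within_ln_ln_of_perp hpa hrb hpS (h r hrb) hpr

lemma within_cp_ln_of_perp {n : ZMod 300} {b : Ln K₁₁} {hb : b ∉ Set.range spread}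
    {p q : Pt K₁₁} (hp : Inc p (spread n)) (hq : Inc q b) (hqS : ¬ OnSpread q) (h : Perp p q) :
    Within 6 (cp n (door p)) (ln b hb) := by
  obtain ⟨z, m, l, hpm, hzm, hzl, hql⟩ := h.exists_path
  have hzq := (within_of_inc (notMem_range_of_inc hql hqS) hzl hql).trans
    (within_pt_ln (h := hb) hq)
  by_cases hm : m ∈ Set.range spread
  · obtain ⟨k, rfl⟩ := hm
    obtain rfl := eq_of_col hp hpm (.refl p)
    exact ((within_pt_cp hzm _).symm.trans hzq).mono (by norm_num)
  · exact ((within_pt_cp_door hp).symm.trans (within_of_inc hm hpm hzm)).trans hzq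

lemma within_cp_ln (n : ZMod 300) (i : Fin 6) (b : Ln K₁₁) (hb : b ∉ Set.range spread) :
    Within 6 (cp n i) (ln b hb) := by
  by_cases h : ∃ q, Inc q b ∧ OnSpread q
  · obtain ⟨q, hqb, k, hqk⟩ := h
    by_cases hk : k = n
    · subst hk
      exact ((within_pt_cp hqk i).symm.trans (within_pt_ln hqb)).mono (by norm_num)
    · obtain ⟨t, ht⟩ : ∃ t, ¬ Perp q (doorPt n i t) := by
        by_contra! hall
        obtain ⟨u, hu, hqu⟩ := exists_inc_col two_ne_zero_K fun w hw =>
          Perp.of_two (doorPt_ne n i) (inc_doorPt ..) (inc_doorPt ..) (hall _) (hall _) hw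
        exact hk (eq_of_col hqk hu hqu)
      obtain ⟨r, hrb, hpr⟩ := exists_inc_perp (doorPt n i t) b
      have := within_cp_ln_of_perp (hb := hb) (inc_doorPt n i t) hrb (fun hr => ht ?_) hpr
      · rwa [door_doorPt] at this
      · rw [eq_of_onSpread hb hqb hrb ⟨k, hqk⟩ hr]
        exact hpr.symm
  · push Not at h
    obtain ⟨r, hrb, hpr⟩ := exists_inc_perp (doorPt n i true) b
    have := within_cp_ln_of_perp (hb := hb) (inc_doorPt n i true) hrb (h r hrb) hpr
    rwa [door_doorPt] at this

lemma within_pt_pt (a b : Pt K₁₁) : Within 6 (pt a) (pt b) := by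
  by_cases hab : Perp a b
  · exact hab.within.mono (by norm_num)
  by_contra hfar
  have path (o : Option K₁₁) : ∃ p z m l, Inc p (lnOf a o) ∧ Inc p m ∧ Inc z m ∧ Inc z l ∧
      Inc b l := by
    obtain ⟨p, hp, hbp⟩ := exists_inc_perp b (lnOf a o)
    obtain ⟨z, m, l, h⟩ := hbp.symm.exists_path
    exact ⟨p, z, m, l, hp, h⟩
  choose p z m l hpo hpm hzm hzl hbl using path
  have hap (o) : Col a (p o) := .of_inc (inc_lnOf a o) (hpo o)
  have hpz (o) : Col (p o) (z o) := .of_inc (hpm o) (hzm o)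
  have hzb (o) : Col (z o) b := .of_inc (hzl o) (hbl o)
  have haz (o) : Perp a (z o) := .of_col_of_col two_ne_zero_K (hap o) (hpz o)
  have not_col_az (o) : ¬ Col a (z o) := fun h => hab (.of_col_of_col two_ne_zero_K h (hzb o))
  have not_col_pb (o) : ¬ Col (p o) b := fun h => hab (.of_col_of_col two_ne_zero_K (hap o) h)
  have hpa (o) : a ≠ p o := fun h => not_col_az o (by rw [h]; exact hpz o)
  have hpz' (o) : p o ≠ z o := fun h => not_col_pb o (by rw [h]; exact hzb o)
  have eq_of_p {o o'} (h : p o = p o') : o = o' := lnOf_injective a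
    (line_unique (hpa o) (inc_lnOf a o) (hpo o) (inc_lnOf a o') (by rw [h]; exact hpo o'))
  have inj_l : Function.Injective l := by
    intro o o' h
    by_contra hne
    have hz : z o = z o' := by
      by_contra hz
      exact hab (.of_two hz (hzl o) (by rw [h]; exact hzl o') (haz o) (haz o') (hbl o))
    exact not_col_az o (.of_two_middles two_ne_zero_K (fun h => hne (eq_of_p h)) (hap o) (hpz o)
      (hap o') (by rw [hz]; exact hpz o'))
  have inj_m : Function.Injective m := by
    intro o o' h
    by_contra hne
    have ham : Inc a (m o) := (hap o).inc_of_two two_ne_zero_K (fun h => hne (eq_of_p h)) (hpm o)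
      (by rw [h]; exact hpm o') (hap o')
    exact not_col_az o (.of_inc ham (hzm o))
  have some_mem (o) : lnOf a o ∈ Set.range spread ∨ m o ∈ Set.range spread ∨
      l o ∈ Set.range spread := by
    by_contra! h
    exact hfar (((within_of_inc h.1 (inc_lnOf a o) (hpo o)).trans
      (within_of_inc h.2.1 (hpm o) (hzm o))).trans (within_of_inc h.2.2 (hzl o) (hbl o)))
  by_cases hm : ∃ o, m o ∈ Set.range spread
  · obtain ⟨o, k, hk⟩ := hm
    have all (o') : ∃ k', spread k' = m o' := by
      rcases some_mem o' with ⟨k', h'⟩ | h' | ⟨k', h'⟩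
      · exfalso
        obtain rfl := eq_of_col (n := k') (m := k) (by rw [h']; exact inc_lnOf a o')
          (by rw [hk]; exact hpm o) (hap o)
        refine not_col_az o (.of_inc (m := m o) ?_ (hzm o))
        rw [← hk, h']
        exact inc_lnOf a o'
      · exact h'
      · exfalso
        obtain rfl := eq_of_col (n := k) (m := k') (by rw [hk]; exact hzm o)
          (by rw [h']; exact hbl o') (hzb o)
        refine not_col_pb o (.of_inc (m := m o) (hpm o) ?_)
        rw [← hk, h']
        exact hbl o'
    choose f hf using all
    refine not_perp_spread a (f := f) (fun o o' h => inj_m ?_) fun o x hx => ?_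
    · rw [← hf, ← hf, h]
    · rw [hf] at hx
      exact .of_two (hpz' o) (hpm o) (hzm o) ((hap o).perp two_ne_zero_K) (haz o) hx
  · push Not at hm
    have h1 (o o') (h : lnOf a o ∈ Set.range spread) (h' : lnOf a o' ∈ Set.range spread) :
        o = o' := by
      obtain ⟨k, hk⟩ := h
      obtain ⟨k', hk'⟩ := h'
      apply lnOf_injective a
      rw [← hk, ← hk', eq_of_col (n := k) (m := k') (p := a) (by rw [hk]; exact inc_lnOf a o)
        (by rw [hk']; exact inc_lnOf a o') (.refl a)]
    have h2 (o o') (h : l o ∈ Set.range spread) (h' : l o' ∈ Set.range spread) : o = o' := by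
      obtain ⟨k, hk⟩ := h
      obtain ⟨k', hk'⟩ := h'
      apply inj_l
      rw [← hk, ← hk', eq_of_col (n := k) (m := k') (p := b) (by rw [hk]; exact hbl o)
        (by rw [hk']; exact hbl o') (.refl b)]
    have n0 : (none : Option K₁₁) ≠ some 0 := by simp
    have n1 : (none : Option K₁₁) ≠ some 1 := by simp
    have n01 : (some 0 : Option K₁₁) ≠ some 1 := by simp
    have s (o) : lnOf a o ∈ Set.range spread ∨ l o ∈ Set.range spread :=
      (some_mem o).imp_right fun h => h.resolve_left (hm o)
    have f0 := fun h h' => n0 (h1 _ _ h h')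
    have f1 := fun h h' => n1 (h1 _ _ h h')
    have f01 := fun h h' => n01 (h1 _ _ h h')
    have g0 := fun h h' => n0 (h2 _ _ h h')
    have g1 := fun h h' => n1 (h2 _ _ h h')
    have g01 := fun h h' => n01 (h2 _ _ h h')
    have s0 := s none
    have s1 := s (some 0)
    have s2 := s (some 1)
    clear * - f0 f1 f01 g0 g1 g01 s0 s1 s2
    tauto

lemma within_six (u v : Vtx) : Within 6 u v := by
  rcases u with x | ⟨m, hm⟩ | ⟨n, i⟩ <;> rcases v with y | ⟨m', hm'⟩ | ⟨n', j⟩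
  · exact within_pt_pt x y
  · exact within_pt_ln_six x m' hm'
  · exact within_pt_cp_six x n' j
  · exact (within_pt_ln_six y m hm).symm
  · exact within_ln_ln m m' hm hm'
  · exact (within_cp_ln n' j m hm).symm
  · exact (within_pt_cp_six y n i).symm
  · exact within_cp_ln n i m' hm'
  · exact (within_cp_cp n n' i j).mono (by norm_num)

end SplitCayley

/-- There exists a connected finite simple graph with exactly 355812 vertices,
maximum degree at most 12, and diameter at most 6. -/
theorem exists_connected_graph_card_355812_maxDegree_le_12_diam_le_6 :
    ∃ G : SimpleGraph (Fin 355812), G.Connected ∧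
      (∀ v : Fin 355812, (G.neighborSet v).ncard ≤ 12) ∧ G.diam ≤ 6 := by
  have : Finite SplitCayley.Vtx :=
    Nat.finite_of_card_ne_zero (by rw [SplitCayley.card_vtx]; norm_num)
  let e : SplitCayley.Vtx ≃ Fin 355812 := Finite.equivFinOfCardEq SplitCayley.card_vtx
  let φ : SplitCayley.graph.comap e.symm ≃g SplitCayley.graph := SimpleGraph.Iso.comap e.symm _
  have hdist (u v : Fin 355812) : (SplitCayley.graph.comap e.symm).edist u v ≤ 6 := by
    obtain ⟨w, hw⟩ := SplitCayley.within_six (φ u) (φ v)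
    have h := ((w.map φ.symm.toHom).copy (φ.symm_apply_apply u) (φ.symm_apply_apply v)).edist_le
    rw [SimpleGraph.Walk.length_copy, SimpleGraph.Walk.length_map] at h
    exact h.trans (by exact_mod_cast hw)
  have hdiam : (SplitCayley.graph.comap e.symm).ediam ≤ 6 := SimpleGraph.ediam_le_iff.2 hdist
  refine ⟨SplitCayley.graph.comap e.symm, ?_, fun v => ?_, ?_⟩
  · have : Nonempty (Fin 355812) := ⟨e (.pt .p0)⟩
    exact SimpleGraph.connected_of_ediam_ne_top (ne_top_of_le_ne_top (by decide) hdiam)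
  · have h : (SplitCayley.graph.comap e.symm).neighborSet v =
        e.symm ⁻¹' SplitCayley.graph.neighborSet (e.symm v) := rfl
    rw [h, ← Equiv.image_eq_preimage_symm, Set.ncard_image_of_injective _ e.injective]
    exact SplitCayley.ncard_neighborSet_le _
  · exact ENat.toNat_le_of_le_natCast hdiam
end

section
/- There exists a connected finite simple graph with exactly 806636 vertices, maximum degree at most 14, and diameter at most 6. -/
/-- `Reach r n a b`: `b` is joined to `a` by at most `n` steps along `r` or its converse. -/
inductive Reach {α : Type*} (r : α → α → Prop) : ℕ → α → α → Prop
  | refl (n : ℕ) (a : α) : Reach r n a a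
  | step {n : ℕ} {a b c : α} : r a b ∨ r b a → Reach r n b c → Reach r (n + 1) a c

namespace Reach

variable {α β : Type*} {r : α → α → Prop} {r' : β → β → Prop} {m n : ℕ} {a b c : α}

theorem mono (h : Reach r m a b) (hmn : m ≤ n) : Reach r n a b := by
  induction h generalizing n with
  | refl => exact .refl _ _
  | step e _ ih =>
    obtain ⟨n, rfl⟩ : ∃ k, n = k + 1 := ⟨n - 1, by omega⟩
    exact .step e (ih (by omega))

theorem trans (h : Reach r m a b) (h' : Reach r n b c) : Reach r (m + n) a c := by
  induction h with
  | refl => exact h'.mono (by omega)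
  | step e _ ih => exact (Reach.step e (ih h')).mono (by omega)

theorem of_rel (h : r a b) : Reach r 1 a b := .step (.inl h) (.refl 0 b)

theorem symm (h : Reach r n a b) : Reach r n b a := by
  induction h with
  | refl => exact .refl _ _
  | step e _ ih => exact ih.trans (.step e.symm (.refl 0 _))

theorem map (f : α → β) (hf : ∀ x y, r x y → r' (f x) (f y)) (h : Reach r n a b) :
    Reach r' n (f a) (f b) := by
  induction h with
  | refl => exact .refl _ _
  | step e _ ih => exact .step (e.imp (hf _ _) (hf _ _)) ih

theorem exists_walk (h : Reach r n a b) :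
    ∃ p : (SimpleGraph.fromRel r).Walk a b, p.length ≤ n := by
  induction h with
  | refl => exact ⟨.nil, Nat.zero_le _⟩
  | @step n a b c e _ ih =>
    obtain ⟨p, hp⟩ := ih
    by_cases hab : a = b
    · subst hab
      exact ⟨p, hp.trans (Nat.le_succ n)⟩
    · exact ⟨.cons ((SimpleGraph.fromRel_adj r a b).2 ⟨hab, e⟩) p, by simpa using hp⟩

end Reach

/-- The vertices of the split Cayley hexagon over `K` at distance more than two from a fixed flag,
in coordinates. Those labelled `false` hang below the point of the flag, those labelled `true`
below its line; dropping the last coordinate gives the parent. -/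
inductive HexVertex (K : Type*)
  | tri (s : Bool) (x₁ x₂ x₃ : K)
  | quad (s : Bool) (x₁ x₂ x₃ x₄ : K)
  | quint (s : Bool) (x₁ x₂ x₃ x₄ x₅ : K)

namespace HexVertex

variable {K : Type*} [Field K]

/-- Incidence of the vertices of full coordinate length. -/
def Incident (k b c d e a f g h m : K) : Prop :=
  f = a ^ 3 * k - 3 * a ^ 2 * b + 3 * a * d - e ∧
  g = -a ^ 2 * k + 2 * a * b - d ∧
  h = -a ^ 3 * k ^ 2 + 3 * a ^ 2 * k * b - 3 * a * b ^ 2 + 3 * b * d - k * e - c ∧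
  m = a * k - b

/-- The edges of the hexagon, each in one orientation. -/
inductive Edge : HexVertex K → HexVertex K → Prop
  | quad (s : Bool) (x₁ x₂ x₃ x₄ : K) : Edge (.quad s x₁ x₂ x₃ x₄) (.tri s x₁ x₂ x₃)
  | quint (s : Bool) (x₁ x₂ x₃ x₄ x₅ : K) :
      Edge (.quint s x₁ x₂ x₃ x₄ x₅) (.quad s x₁ x₂ x₃ x₄)
  | cross {k b c d e a f g h m : K} (hI : Incident k b c d e a f g h m) :
      Edge (.quint false k b c d e) (.quint true a f g h m)

/-- Translation by the unipotent element with parameters `k b c d e` that moves the origin of the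
`false` side to `(k, b, c, d, e)` and fixes the first coordinate on the `true` side. -/
def translate (k₀ b₀ c₀ d₀ e₀ : K) : HexVertex K → HexVertex K
  | tri false k b c => tri false (k + k₀) (b + b₀) (c + c₀ + 3 * b * d₀ - k * e₀)
  | quad false k b c d => quad false (k + k₀) (b + b₀) (c + c₀ + 3 * b * d₀ - k * e₀) (d + d₀)
  | quint false k b c d e =>
      quint false (k + k₀) (b + b₀) (c + c₀ + 3 * b * d₀ - k * e₀) (d + d₀) (e + e₀)
  | tri true a f g => tri true a (f + (a ^ 3 * k₀ - 3 * a ^ 2 * b₀ + 3 * a * d₀ - e₀))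
      (g + (-a ^ 2 * k₀ + 2 * a * b₀ - d₀))
  | quad true a f g h => quad true a (f + (a ^ 3 * k₀ - 3 * a ^ 2 * b₀ + 3 * a * d₀ - e₀))
      (g + (-a ^ 2 * k₀ + 2 * a * b₀ - d₀))
      (h + (-a ^ 3 * k₀ ^ 2 + 3 * a ^ 2 * k₀ * b₀ - 3 * a * b₀ ^ 2 + 3 * b₀ * d₀ - k₀ * e₀ - c₀)
        + k₀ * f + 3 * (a * k₀ - b₀) * g)
  | quint true a f g h m => quint true a (f + (a ^ 3 * k₀ - 3 * a ^ 2 * b₀ + 3 * a * d₀ - e₀))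
      (g + (-a ^ 2 * k₀ + 2 * a * b₀ - d₀))
      (h + (-a ^ 3 * k₀ ^ 2 + 3 * a ^ 2 * k₀ * b₀ - 3 * a * b₀ ^ 2 + 3 * b₀ * d₀ - k₀ * e₀ - c₀)
        + k₀ * f + 3 * (a * k₀ - b₀) * g)
      (m + (a * k₀ - b₀))

theorem Edge.translate (k₀ b₀ c₀ d₀ e₀ : K) {v w : HexVertex K} (h : Edge v w) :
    Edge (translate k₀ b₀ c₀ d₀ e₀ v) (HexVertex.translate k₀ b₀ c₀ d₀ e₀ w) := by
  cases h with
  | quad s => cases s <;> exact .quad ..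
  | quint s => cases s <;> exact .quint ..
  | cross hI =>
    obtain ⟨rfl, rfl, rfl, rfl⟩ := hI
    exact .cross ⟨by ring, by ring, by ring, by ring⟩

/-- The unipotent element that adds `t` to the first coordinate on the `true` side and fixes the
origin of the `false` side. -/
def shear (t : K) : HexVertex K → HexVertex K
  | tri false k b c =>
      tri false k (b + t * k) (c + t ^ 3 * k ^ 2 + 3 * t ^ 2 * k * b + 3 * t * b ^ 2)
  | quad false k b c d =>
      quad false k (b + t * k) (c + t ^ 3 * k ^ 2 + 3 * t ^ 2 * k * b + 3 * t * b ^ 2)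
        (d + 2 * t * b + t ^ 2 * k)
  | quint false k b c d e =>
      quint false k (b + t * k) (c + t ^ 3 * k ^ 2 + 3 * t ^ 2 * k * b + 3 * t * b ^ 2)
        (d + 2 * t * b + t ^ 2 * k) (e + 3 * t * d + 3 * t ^ 2 * b + t ^ 3 * k)
  | tri true a f g => tri true (a + t) f g
  | quad true a f g h => quad true (a + t) f g h
  | quint true a f g h m => quint true (a + t) f g h m

theorem Edge.shear (t : K) {v w : HexVertex K} (h : Edge v w) :
    Edge (shear t v) (HexVertex.shear t w) := by
  cases h with
  | quad s => cases s <;> exact .quad ..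
  | quint s => cases s <;> exact .quint ..
  | cross hI =>
    obtain ⟨rfl, rfl, rfl, rfl⟩ := hI
    exact .cross ⟨by ring, by ring, by ring, by ring⟩

/-- The automorphism carrying the origin of the `false` side to `(k, b, c, d, e)` and adding `t`
to the first coordinate on the `true` side. -/
def move (k b c d e t : K) (v : HexVertex K) : HexVertex K := translate k b c d e (shear t v)

theorem reach_of_move {k b c d e t : K} {n : ℕ} {v w v' w' : HexVertex K}
    (h : Reach Edge n v w) (hv : move k b c d e t v = v') (hw : move k b c d e t w = w') :
    Reach Edge n v' w' := by
  subst hv hw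
  exact h.map _ fun _ _ he => (he.shear t).translate k b c d e

theorem reach_quad_tri (s : Bool) (x₁ x₂ x₃ x₄ : K) :
    Reach Edge 1 (quad s x₁ x₂ x₃ x₄) (tri s x₁ x₂ x₃) := .of_rel (.quad ..)

theorem reach_quint_quad (s : Bool) (x₁ x₂ x₃ x₄ x₅ : K) :
    Reach Edge 1 (quint s x₁ x₂ x₃ x₄ x₅) (quad s x₁ x₂ x₃ x₄) := .of_rel (.quint ..)

theorem reach_quint_tri (s : Bool) (x₁ x₂ x₃ x₄ x₅ : K) :
    Reach Edge 2 (quint s x₁ x₂ x₃ x₄ x₅) (tri s x₁ x₂ x₃) :=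
  (reach_quint_quad ..).trans (reach_quad_tri ..)

theorem Incident.reach {k b c d e a f g h m : K} (hI : Incident k b c d e a f g h m) :
    Reach Edge 1 (quint false k b c d e) (quint true a f g h m) := .of_rel (.cross hI)

/-- Two vertices of full length with a common parent. -/
theorem reach_sibling (s : Bool) (x₁ x₂ x₃ x₄ x₅ y₅ : K) :
    Reach Edge 2 (quint s x₁ x₂ x₃ x₄ x₅) (quint s x₁ x₂ x₃ x₄ y₅) :=
  (reach_quint_quad ..).trans (reach_quint_quad ..).symm

/-- Two vertices of full length with a common grandparent. -/
theorem reach_cousin (s : Bool) (x₁ x₂ x₃ x₄ x₅ y₄ y₅ : K) :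
    Reach Edge 4 (quint s x₁ x₂ x₃ x₄ x₅) (quint s x₁ x₂ x₃ y₄ y₅) :=
  (reach_quint_tri ..).trans (reach_quint_tri ..).symm

theorem exists_incident_true (k b c d e a : K) : ∃ f g h m, Incident k b c d e a f g h m :=
  ⟨_, _, _, _, rfl, rfl, rfl, rfl⟩

theorem incident_false (k a f g h m : K) :
    Incident k (a * k - m) (-h - a ^ 3 * k ^ 2 + 3 * a ^ 2 * k * (a * k - m)
      - 3 * a * (a * k - m) ^ 2 + 3 * (a * k - m) * (a ^ 2 * k - 2 * a * m - g)
      - k * (a ^ 3 * k - 3 * a ^ 2 * m - 3 * a * g - f))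
      (a ^ 2 * k - 2 * a * m - g) (a ^ 3 * k - 3 * a ^ 2 * m - 3 * a * g - f) a f g h m :=
  ⟨by ring, by ring, by ring, by ring⟩

theorem exists_incident_false (k a f g h m : K) : ∃ b c d e, Incident k b c d e a f g h m :=
  ⟨_, _, _, _, incident_false k a f g h m⟩

theorem Incident.eq_of_incident {k b c d e b' c' d' e' a f g h m : K}
    (hI : Incident k b c d e a f g h m) (hJ : Incident k b' c' d' e' a f g h m) :
    b = b' ∧ c = c' ∧ d = d' ∧ e = e' := by
  obtain ⟨i₁, i₂, i₃, i₄⟩ := hI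
  obtain ⟨j₁, j₂, j₃, j₄⟩ := hJ
  obtain rfl : b = b' := by linear_combination i₄ - j₄
  obtain rfl : d = d' := by linear_combination i₂ - j₂
  obtain rfl : e = e' := by linear_combination i₁ - j₁
  exact ⟨rfl, by linear_combination i₃ - j₃, rfl, rfl⟩

theorem incident_origin (a : K) : Incident 0 0 0 0 0 a 0 0 0 0 :=
  ⟨by ring, by ring, by ring, by ring⟩

theorem incident_origin' (k : K) : Incident k 0 0 0 0 0 0 0 0 0 :=
  ⟨by ring, by ring, by ring, by ring⟩

/-- The neighbours of `quint true 0 f g h m`. -/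
theorem incident_zero (k f g h m : K) :
    Incident k (-m) (3 * m * g + k * f - h) (-g) (-f) 0 f g h m :=
  ⟨by ring, by ring, by ring, by ring⟩

/-- The second neighbours of the origin. -/
theorem incident_second (k a : K) :
    Incident k (a * k) (a ^ 3 * k ^ 2) (a ^ 2 * k) (a ^ 3 * k) a 0 0 0 0 :=
  ⟨by ring, by ring, by ring, by ring⟩

/-- The third neighbours of the origin. -/
theorem incident_third (k a p : K) :
    Incident k (a * k) (a ^ 3 * k ^ 2) (a ^ 2 * k) (a ^ 3 * k) p
      ((p - a) ^ 3 * k) (-(p - a) ^ 2 * k) (-(p - a) ^ 3 * k ^ 2) ((p - a) * k) :=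
  ⟨by ring, by ring, by ring, by ring⟩

theorem reach_tri_tri (k b c a f g : K) : Reach Edge 5 (tri false k b c) (tri true a f g) := by
  have h : Incident k b c (-a ^ 2 * k + 2 * a * b - g)
      (a ^ 3 * k - 3 * a ^ 2 * b + 3 * a * (-a ^ 2 * k + 2 * a * b - g) - f) a f g _ _ :=
    ⟨by ring, by ring, rfl, rfl⟩
  exact ((reach_quint_tri ..).symm.trans h.reach).trans (reach_quint_tri ..)

theorem exists_reach_tri_quad (s : Bool) (x₁ x₂ z₁ z₂ z₃ z₄ : K) :
    ∃ x₃, Reach Edge 4 (tri s x₁ x₂ x₃) (quad (!s) z₁ z₂ z₃ z₄) := by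
  cases s with
  | false =>
    have h := incident_false x₁ z₁ z₂ z₃ z₄ (z₁ * x₁ - x₂)
    rw [sub_sub_cancel] at h
    exact ⟨_, ((reach_quint_tri ..).symm.trans h.reach).trans (reach_quint_quad ..)⟩
  | true =>
    have h : Incident z₁ z₂ z₃ z₄
        (x₁ ^ 3 * z₁ - 3 * x₁ ^ 2 * z₂ + 3 * x₁ * z₄ - x₂) x₁ x₂ _ _ _ :=
      ⟨by ring, rfl, rfl, rfl⟩
    exact ⟨_, ((reach_quint_tri ..).symm.trans h.reach.symm).trans (reach_quint_quad ..)⟩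

theorem exists_reach_tri_quint (s : Bool) (x₁ x₂ z₁ z₂ z₃ z₄ z₅ : K) (hne : x₁ ≠ z₁) :
    ∃ x₃, Reach Edge 4 (tri s x₁ x₂ x₃) (quint s z₁ z₂ z₃ z₄ z₅) := by
  have h₀ : x₁ - z₁ ≠ 0 := sub_ne_zero.2 hne
  cases s with
  | false =>
    obtain ⟨f, g, h, m, hI⟩ := exists_incident_true z₁ z₂ z₃ z₄ z₅ ((x₂ - z₂) / (x₁ - z₁))
    have hJ := incident_false x₁ ((x₂ - z₂) / (x₁ - z₁)) f g h m
    rw [show (x₂ - z₂) / (x₁ - z₁) * x₁ - m = x₂ by rw [hI.2.2.2]; field_simp; ring] at hJ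
    exact ⟨_, ((reach_quint_tri ..).symm.trans hJ.reach).trans hI.reach.symm⟩
  | true =>
    obtain ⟨k, hk⟩ : ∃ k, (x₁ - z₁) ^ 3 * k =
        x₂ - z₂ + 3 * (x₁ - z₁) * z₃ - 3 * (x₁ - z₁) ^ 2 * z₅ :=
      ⟨_, mul_div_cancel₀ _ (pow_ne_zero 3 h₀)⟩
    obtain ⟨b, c, d, e, hI⟩ := exists_incident_false k z₁ z₂ z₃ z₄ z₅
    obtain ⟨f, g, h, m, hJ⟩ := exists_incident_true k b c d e x₁
    rw [show f = x₂ by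
      rw [hJ.1]
      linear_combination hk - hI.1 + 3 * (x₁ - z₁) * hI.2.1 - 3 * (x₁ - z₁) ^ 2 * hI.2.2.2] at hJ
    exact ⟨_, ((reach_quint_tri ..).symm.trans hJ.reach.symm).trans hI.reach⟩

theorem reach_tri_quad (s : Bool) (x₁ x₂ x₃ z₁ z₂ z₃ z₄ : K) (hne : x₁ ≠ z₁) :
    Reach Edge 5 (tri s x₁ x₂ x₃) (quad s z₁ z₂ z₃ z₄) := by
  have key : ∀ {y₁ y₂ y₃ y₄ : K}, y₁ ≠ 0 →
      Reach Edge 5 (tri s 0 0 0) (quad s y₁ y₂ y₃ y₄) := by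
    intro y₁ y₂ y₃ y₄ h₀
    cases s with
    | false =>
      obtain ⟨e, he⟩ : ∃ e, y₁ * e = -(y₂ / y₁) ^ 3 * y₁ ^ 2 + 3 * (y₂ / y₁) ^ 2 * y₁ * y₂
          - 3 * (y₂ / y₁) * y₂ ^ 2 + 3 * y₂ * y₄ - y₃ := ⟨_, mul_div_cancel₀ _ h₀⟩
      obtain ⟨f, g, h, m, hI⟩ := exists_incident_true y₁ y₂ y₃ y₄ e (y₂ / y₁)
      have hm : m = 0 := by rw [hI.2.2.2]; field_simp; ring
      have hh : h = 0 := by rw [hI.2.2.1]; linear_combination -he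
      subst hm hh
      have hJ : Incident 0 0 0 (-g) (-(3 * (y₂ / y₁) * g) - f) (y₂ / y₁) f g 0 0 :=
        ⟨by ring, by ring, by ring, by ring⟩
      exact (((reach_quint_tri ..).symm.trans hJ.reach).trans hI.reach.symm).trans
        (reach_quint_quad ..)
    | true =>
      obtain ⟨m, hm⟩ : ∃ m, y₁ ^ 2 * m = y₂ + y₁ * y₃ := ⟨_, mul_div_cancel₀ _ (pow_ne_zero 2 h₀)⟩
      obtain ⟨k, hk⟩ : ∃ k, y₁ ^ 2 * k = -y₃ - 2 * y₁ * m :=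
        ⟨_, mul_div_cancel₀ _ (pow_ne_zero 2 h₀)⟩
      have hI : Incident k (-m) (-y₁ ^ 3 * k ^ 2 - 3 * y₁ ^ 2 * k * m - 3 * y₁ * m ^ 2 - y₄) 0 0
          y₁ y₂ y₃ y₄ (y₁ * k + m) :=
        ⟨by linear_combination -hm - y₁ * hk, by linear_combination hk, by ring, by ring⟩
      have hJ : Incident k (-m) (-y₁ ^ 3 * k ^ 2 - 3 * y₁ ^ 2 * k * m - 3 * y₁ * m ^ 2 - y₄) 0 0
          0 0 0 _ m := ⟨by ring, by ring, rfl, by ring⟩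
      exact (((reach_quint_tri ..).symm.trans hJ.reach.symm).trans hI.reach).trans
        (reach_quint_quad ..)
  have h₀ : z₁ - x₁ ≠ 0 := sub_ne_zero.2 hne.symm
  cases s with
  | false =>
    refine reach_of_move (k := x₁) (b := x₂) (c := x₃) (d := 0) (e := 0) (t := 0)
      (key (y₂ := z₂ - x₂) (y₃ := z₃ - x₃) (y₄ := z₄) h₀) ?_ ?_ <;>
    · simp [move, translate, shear]
  | true =>
    refine reach_of_move (k := 0) (b := 0) (c := 0) (d := -x₃) (e := -3 * x₁ * x₃ - x₂) (t := x₁)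
      (key (y₂ := z₂ - x₂ + 3 * (z₁ - x₁) * x₃) (y₃ := z₃ - x₃) (y₄ := z₄) h₀) ?_ ?_
    · simp only [move, translate, shear]
      congr 1 <;> ring
    · simp only [move, translate, shear]
      congr 1 <;> ring

theorem reach_tri_quint (s : Bool) (x₁ x₂ x₃ y₁ y₂ y₃ y₄ y₅ : K) :
    (∃ t, Reach Edge 3 (tri s x₁ x₂ t) (quint (!s) y₁ y₂ y₃ y₄ y₅)) ∨
      Reach Edge 5 (tri s x₁ x₂ x₃) (quint (!s) y₁ y₂ y₃ y₄ y₅) := by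
  cases s with
  | false =>
    have key : ∀ {f g h m : K}, m ≠ 0 →
        Reach Edge 5 (tri false 0 0 0) (quint true 0 f g h m) := by
      intro f g h m hm
      by_cases hh : h = 0
      · subst hh
        have hI : Incident 0 0 0 (-g) (-f) 0 f g 0 0 := ⟨by ring, by ring, by ring, by ring⟩
        exact ((reach_quint_tri ..).symm.trans hI.reach).trans (reach_sibling ..)
      · obtain ⟨A, hA⟩ : ∃ A, m ^ 2 * A = h := ⟨_, mul_div_cancel₀ _ (pow_ne_zero 2 hm)⟩
        obtain ⟨k, hk⟩ : ∃ k, A * k = -m := by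
          have : A ≠ 0 := by rintro rfl; simp at hA; exact hh hA.symm
          exact ⟨_, mul_div_cancel₀ _ this⟩
        have hI := incident_zero k f g h m
        obtain ⟨f', g', h', m', hJ⟩ :=
          exists_incident_true k (-m) (3 * m * g + k * f - h) (-g) (-f) A
        have hm' : m' = 0 := by rw [hJ.2.2.2]; linear_combination hk
        have hh' : h' = 0 := by
          rw [hJ.2.2.1]
          linear_combination -hA - (A ^ 2 * k + 2 * A * m) * hk
        subst hm' hh'
        have hL : Incident 0 0 0 (-g') (-(3 * A * g') - f') A f' g' 0 0 :=
          ⟨by ring, by ring, by ring, by ring⟩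
        exact (((reach_quint_tri ..).symm.trans hL.reach).trans hJ.reach.symm).trans hI.reach
    by_cases hb : y₁ * x₁ - y₅ = x₂
    · have h := incident_false x₁ y₁ y₂ y₃ y₄ y₅
      rw [hb] at h
      exact .inl ⟨_, (reach_quint_tri ..).symm.trans h.reach⟩
    · refine .inr (reach_of_move (k := x₁) (b := x₂) (c := x₃) (d := 0) (e := 0) (t := y₁)
        (key (m := y₅ - (y₁ * x₁ - x₂)) (f := y₂ - (y₁ ^ 3 * x₁ - 3 * y₁ ^ 2 * x₂))
          (g := y₃ - (-y₁ ^ 2 * x₁ + 2 * y₁ * x₂))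
          (h := y₄ - (-y₁ ^ 3 * x₁ ^ 2 + 3 * y₁ ^ 2 * x₁ * x₂ - 3 * y₁ * x₂ ^ 2 - x₃)
            - x₁ * (y₂ - (y₁ ^ 3 * x₁ - 3 * y₁ ^ 2 * x₂))
            - 3 * (y₁ * x₁ - x₂) * (y₃ - (-y₁ ^ 2 * x₁ + 2 * y₁ * x₂)))
          fun h => hb (by linear_combination -h)) ?_ ?_) <;>
      · simp only [move, translate, shear, Bool.not_false]
        congr 1 <;> ring
  | true =>
    have key : ∀ {f g : K}, f ≠ 0 →
        Reach Edge 5 (tri true 0 f g) (quint false 0 0 0 0 0) := by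
      intro f g hf
      by_cases hg : g = 0
      · subst hg
        have hI : Incident 0 0 0 0 (-f) 0 f 0 0 0 := ⟨by ring, by ring, by ring, by ring⟩
        exact ((reach_quint_tri ..).symm.trans hI.reach.symm).trans (reach_sibling ..)
      · obtain ⟨A, hA⟩ : ∃ A, g * A = f := ⟨_, mul_div_cancel₀ _ hg⟩
        obtain ⟨k, hk⟩ : ∃ k, A ^ 2 * k = -g := by
          have : A ≠ 0 := by rintro rfl; simp at hA; exact hf hA.symm
          exact ⟨_, mul_div_cancel₀ _ (pow_ne_zero 2 this)⟩
        obtain ⟨h, m, hJ⟩ : ∃ h m, Incident k (A * k) (A ^ 3 * k ^ 2) (A ^ 2 * k) (A ^ 3 * k)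
            0 f g h m :=
          ⟨_, _, by linear_combination -hA + A * hk, by linear_combination hk, rfl, rfl⟩
        exact (((reach_quint_tri ..).symm.trans hJ.reach.symm).trans
          (incident_second k A).reach).trans (incident_origin A).reach.symm
    by_cases hb : x₁ ^ 3 * y₁ - 3 * x₁ ^ 2 * y₂ + 3 * x₁ * y₄ - y₅ = x₂
    · obtain ⟨f, g, h, m, hI⟩ := exists_incident_true y₁ y₂ y₃ y₄ y₅ x₁
      rw [← hI.1] at hb
      subst hb
      exact .inl ⟨_, (reach_quint_tri ..).symm.trans hI.reach.symm⟩
    · refine .inr (reach_of_move (k := y₁) (b := y₂) (c := y₃) (d := y₄) (e := y₅) (t := x₁)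
        (key (f := x₂ - (x₁ ^ 3 * y₁ - 3 * x₁ ^ 2 * y₂ + 3 * x₁ * y₄ - y₅))
          (g := x₃ - (-x₁ ^ 2 * y₁ + 2 * x₁ * y₂ - y₄))
          fun h => hb (by linear_combination -h)) ?_ ?_) <;>
      · simp only [move, translate, shear, Bool.not_true]
        congr 1 <;> ring

/-- A path of length five from the origin through `quint true p …`. -/
theorem reach_origin_of_eqs {A K' p κ f g h m : K}
    (h₁ : (p - A) * κ = p * K' + m)
    (h₂ : -(p - A) ^ 2 * κ = -p ^ 2 * K' - 2 * p * m + g)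
    (h₃ : (p - A) ^ 3 * κ = p ^ 3 * K' + 3 * p ^ 2 * m - 3 * p * g + f)
    (h₄ : -(p - A) ^ 3 * κ ^ 2 = h - p ^ 3 * K' ^ 2 - 3 * p ^ 2 * K' * m - 3 * p * m ^ 2) :
    Reach Edge 5 (quint false 0 0 0 0 0) (quint true 0 f g h m) := by
  have hI : Incident K' (-m) (3 * m * g + K' * f - h) (-g) (-f) p ((p - A) ^ 3 * κ)
      (-(p - A) ^ 2 * κ) (-(p - A) ^ 3 * κ ^ 2) ((p - A) * κ) :=
    ⟨by linear_combination h₃, by linear_combination h₂, by linear_combination h₄,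
      by linear_combination h₁⟩
  exact ((((incident_origin A).reach.trans (incident_second κ A).reach.symm).trans
    (incident_third κ A p).reach).trans hI.reach.symm).trans (incident_zero ..).reach

/-- A path of length five from the origin that passes through siblings after one step. -/
theorem reach_origin_of_sibling {A κ M f g h m : K}
    (h₁ : M = A * κ + m)
    (h₂ : 0 = -A ^ 2 * κ - 2 * A * m + g)
    (h₃ : 0 = A ^ 3 * κ + 3 * A ^ 2 * m - 3 * A * g + f)
    (h₄ : 0 = h - A ^ 3 * κ ^ 2 - 3 * A ^ 2 * κ * m - 3 * A * m ^ 2) :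
    Reach Edge 5 (quint false 0 0 0 0 0) (quint true 0 f g h m) := by
  have hI : Incident κ (-m) (3 * m * g + κ * f - h) (-g) (-f) A 0 0 0 M :=
    ⟨by linear_combination h₃, by linear_combination h₂, by linear_combination h₄,
      by linear_combination h₁⟩
  exact (((incident_origin A).reach.trans (reach_sibling ..)).trans hI.reach.symm).trans
    (incident_zero ..).reach

/-- A path of length five from the origin that passes through siblings after two steps. -/
theorem reach_origin_of_sibling' {A κ f g h m : K} (h₁ : m = -(A * κ)) (h₂ : g = -(A ^ 2 * κ))
    (h₃ : h = 2 * A ^ 3 * κ ^ 2 + κ * f) :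
    Reach Edge 5 (quint false 0 0 0 0 0) (quint true 0 f g h m) := by
  have hI : Incident κ (A * κ) (A ^ 3 * κ ^ 2) (A ^ 2 * κ) (-f) 0 f g h m :=
    ⟨by ring, by linear_combination h₂, by linear_combination h₃, by linear_combination h₁⟩
  exact (((incident_origin A).reach.trans (incident_second κ A).reach.symm).trans
    (reach_sibling ..)).trans hI.reach

theorem reach_quint_quint_of_ne {f g h m : K} (h₁ : m * f ≠ g ^ 2) (h₂ : h ≠ g * m)
    (h₃ : m ^ 2 * f - 2 * g ^ 2 * m + h * g ≠ 0) (h₄ : h * f ≠ g ^ 3) :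
    Reach Edge 5 (quint false 0 0 0 0 0) (quint true 0 f g h m) := by
  obtain ⟨p, hp⟩ : ∃ p, (m ^ 2 * f - 2 * g ^ 2 * m + h * g) * p = h * f - g ^ 3 :=
    ⟨_, mul_div_cancel₀ _ h₃⟩
  have h₁' := sub_ne_zero.2 h₁
  have hp₀ : p ≠ 0 := by
    rintro rfl
    exact h₄ (by linear_combination -hp)
  have hgp : g - p * m ≠ 0 := by
    intro h0
    refine mul_ne_zero h₁' (sub_ne_zero.2 h₂) ?_
    linear_combination -(m ^ 2 * f - 2 * g ^ 2 * m + h * g) * h0 - m * hp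
  have hfp : f - g * p ≠ 0 := by
    intro h0
    refine pow_ne_zero 2 h₁' ?_
    linear_combination (m ^ 2 * f - 2 * g ^ 2 * m + h * g) * h0 + g * hp
  by_cases hq : m * p ^ 2 - 2 * g * p + f = 0
  · obtain ⟨κ, hκ⟩ : ∃ κ, p ^ 2 * κ = g - 2 * p * m := ⟨_, mul_div_cancel₀ _ (pow_ne_zero 2 hp₀)⟩
    have hh : h * p = g ^ 2 - g * p * m + p ^ 2 * m ^ 2 := by
      refine mul_left_cancel₀ hgp ?_
      linear_combination -hp - (h - p * m ^ 2) * hq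
    refine reach_origin_of_sibling (A := p) (κ := κ) (M := p * κ + m) rfl
      (by linear_combination hκ) (by linear_combination -p * hκ - hq) ?_
    refine mul_left_cancel₀ hp₀ ?_
    linear_combination -hh + (p ^ 2 * κ + g - 2 * p * m + 3 * p * m) * hκ
  · obtain ⟨D, hD⟩ : ∃ D, (g - p * m) * D = -(m * p ^ 2 - 2 * g * p + f) :=
      ⟨_, mul_div_cancel₀ _ hgp⟩
    have hD₀ : D ≠ 0 := by
      rintro rfl
      exact hq (by linear_combination hD)
    have hA : (p - D) * (g - p * m) = f - g * p := by linear_combination -hD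
    have hA₀ : p - D ≠ 0 := left_ne_zero_of_mul (hA ▸ hfp)
    obtain ⟨w, hw⟩ : ∃ w, (p - D) * w = g - p * m := ⟨_, mul_div_cancel₀ _ hA₀⟩
    obtain ⟨κ, rfl⟩ : ∃ κ, D * κ = w := ⟨_, mul_div_cancel₀ _ hD₀⟩
    obtain ⟨K', hK'⟩ : ∃ K', p * K' = D * κ - m := ⟨_, mul_div_cancel₀ _ hp₀⟩
    have hh : D * κ * g + p * m ^ 2 = h := by
      refine mul_left_cancel₀ hfp ?_
      linear_combination hp - g * D * κ * hA + g * (g - p * m) * hw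
    refine reach_origin_of_eqs (A := p - D) (p := p) (κ := κ) (K' := K') ?_ ?_ ?_ ?_ <;>
      rw [sub_sub_cancel]
    · linear_combination -hK'
    · linear_combination hw + p * hK'
    · linear_combination -p ^ 2 * hK' - (p + D) * hw - hD
    · linear_combination hh + (p ^ 2 * K' + p * (D * κ - m) + 3 * p * m) * hK' + D * κ * hw

theorem reach_quint_quint_key (f g h m : K) :
    Reach Edge 5 (quint false 0 0 0 0 0) (quint true 0 f g h m) := by
  by_cases h₁ : m * f = g ^ 2
  · by_cases hf : f = 0
    · obtain rfl : g = 0 := pow_eq_zero_iff two_ne_zero |>.1 (h₁.symm.trans (by rw [hf, mul_zero]))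
      subst hf
      exact (incident_origin 0).reach.trans (reach_cousin ..)
    by_cases hg : g = 0
    · subst hg
      obtain rfl : m = 0 := by simpa [hf] using h₁
      exact reach_origin_of_sibling' (A := 0) (κ := h / f) (by ring) (by ring)
        (by field_simp; ring)
    have hm : m ≠ 0 := by
      rintro rfl
      exact pow_ne_zero 2 hg (by linear_combination -h₁)
    obtain ⟨p, rfl⟩ : ∃ p, p * m = g := ⟨_, div_mul_cancel₀ _ hm⟩
    have hp : p ≠ 0 := left_ne_zero_of_mul hg
    obtain rfl : f = p ^ 2 * m := mul_left_cancel₀ hm (by linear_combination h₁)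
    obtain ⟨κ, hκ⟩ : ∃ κ, p ^ 2 * m * κ = h - p * m ^ 2 := ⟨_, mul_div_cancel₀ _ hf⟩
    obtain ⟨K', hK'⟩ : ∃ K', p * K' = p * κ - m := ⟨_, mul_div_cancel₀ _ hp⟩
    refine reach_origin_of_eqs (A := 0) (p := p) (κ := κ) (K' := K') ?_ ?_ ?_ ?_
    · linear_combination -hK'
    · linear_combination p * hK'
    · linear_combination -p ^ 2 * hK'
    · linear_combination hκ + (p ^ 2 * K' + p * (p * κ - m) + 3 * p * m) * hK'
  by_cases h₂ : h = g * m
  · subst h₂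
    by_cases hm : m = 0
    · subst hm
      have hI := incident_zero 0 f g (g * 0) 0
      simp only [mul_zero, zero_mul, add_zero, sub_zero, neg_zero] at hI ⊢
      exact (reach_cousin ..).trans hI.reach
    by_cases hg : g = 0
    · subst hg
      have hI : Incident 0 0 0 0 (-f) 0 f 0 0 0 := ⟨by ring, by ring, by ring, by ring⟩
      rw [zero_mul]
      exact ((reach_sibling ..).trans hI.reach).trans (reach_sibling ..)
    obtain ⟨A, rfl⟩ : ∃ A, A * m = g := ⟨_, div_mul_cancel₀ _ hm⟩
    obtain ⟨κ, rfl⟩ : ∃ κ, -(A * κ) = m := ⟨-m / A, by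
      rw [mul_div_cancel₀ _ (left_ne_zero_of_mul hg), neg_neg]⟩
    obtain ⟨e, rfl⟩ : ∃ e, -e - A ^ 3 * κ = f := ⟨-f - A ^ 3 * κ, by ring⟩
    have hI : Incident 0 0 0 0 e A (-e) 0 0 0 := ⟨by ring, by ring, by ring, by ring⟩
    have hJ : Incident κ (A * κ) (A ^ 3 * κ ^ 2 - κ * e) (A ^ 2 * κ) (A ^ 3 * κ + e)
        A (-e) 0 0 0 := ⟨by ring, by ring, by ring, by ring⟩
    have hL : Incident κ (A * κ) (A ^ 3 * κ ^ 2 - κ * e) (A ^ 2 * κ) (A ^ 3 * κ + e)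
        0 (-e - A ^ 3 * κ) (A * -(A * κ)) (A * -(A * κ) * -(A * κ)) (-(A * κ)) :=
      ⟨by ring, by ring, by ring, by ring⟩
    exact (((reach_sibling ..).trans hI.reach).trans hJ.reach.symm).trans hL.reach
  by_cases h₃ : m ^ 2 * f - 2 * g ^ 2 * m + h * g = 0
  · have hm : m ≠ 0 := by
      rintro rfl
      have : h * g = 0 := by linear_combination h₃
      rcases mul_eq_zero.1 this with rfl | rfl
      · exact h₂ (by ring)
      · exact h₁ (by ring)
    have hg : g ≠ 0 := by
      rintro rfl
      exact h₁ (mul_left_cancel₀ hm (by linear_combination h₃))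
    refine reach_origin_of_sibling' (A := g / m) (κ := -m ^ 2 / g) (by field_simp)
      (by field_simp) ?_
    field_simp
    linear_combination h₃
  by_cases h₄ : h * f = g ^ 3
  · have hg : g ≠ 0 := by
      rintro rfl
      rcases mul_eq_zero.1 (h₄.trans (zero_pow three_ne_zero)) with rfl | rfl
      · exact h₂ (by ring)
      · exact h₁ (by ring)
    have hf : f ≠ 0 := by
      rintro rfl
      exact pow_ne_zero 3 hg (by linear_combination -h₄)
    obtain ⟨A, rfl⟩ : ∃ A, g * A = f := ⟨_, mul_div_cancel₀ _ hg⟩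
    obtain ⟨κ, rfl⟩ : ∃ κ, -(A ^ 2 * κ) = g := ⟨-g / A ^ 2, by
      rw [mul_div_cancel₀ _ (pow_ne_zero 2 (right_ne_zero_of_mul hf)), neg_neg]⟩
    obtain rfl : h = A ^ 3 * κ ^ 2 := mul_right_cancel₀ hf (by linear_combination h₄)
    have hI : Incident κ (A * κ) (A ^ 3 * κ ^ 2) (A ^ 2 * κ) (A ^ 3 * κ) 0 (-(A ^ 2 * κ) * A)
        (-(A ^ 2 * κ)) (A ^ 3 * κ ^ 2) (-(A * κ)) := ⟨by ring, by ring, by ring, by ring⟩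
    exact (((incident_origin A).reach.trans (incident_second κ A).reach.symm).trans
      hI.reach).trans (reach_sibling ..)
  exact reach_quint_quint_of_ne h₁ h₂ h₃ h₄

theorem reach_quint_quint (k b c d e a f g h m : K) :
    Reach Edge 5 (quint false k b c d e) (quint true a f g h m) := by
  refine reach_of_move (k := k) (b := b) (c := c) (d := d) (e := e) (t := a)
    (reach_quint_quint_key (f - (a ^ 3 * k - 3 * a ^ 2 * b + 3 * a * d - e))
      (g - (-a ^ 2 * k + 2 * a * b - d))
      (h - (-a ^ 3 * k ^ 2 + 3 * a ^ 2 * k * b - 3 * a * b ^ 2 + 3 * b * d - k * e - c)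
        - k * (f - (a ^ 3 * k - 3 * a ^ 2 * b + 3 * a * d - e))
        - 3 * (a * k - b) * (g - (-a ^ 2 * k + 2 * a * b - d)))
      (m - (a * k - b))) ?_ ?_ <;>
  · simp only [move, translate, shear]
    congr 1 <;> ring

theorem reach_quint_quad_false_key {k b : K} (c d : K) (hne : ¬(k = 0 ∧ b = 0)) :
    Reach Edge 5 (quint false 0 0 0 0 0) (quad false k b c d) := by
  by_cases hKC : k * c - b ^ 3 = 0
  · have hK : k ≠ 0 := by
      rintro rfl
      exact hne ⟨rfl, (pow_eq_zero_iff three_ne_zero).1 (by linear_combination -hKC)⟩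
    obtain ⟨A, rfl⟩ : ∃ A, A * k = b := ⟨_, div_mul_cancel₀ _ hK⟩
    obtain rfl : c = A ^ 3 * k ^ 2 := mul_left_cancel₀ hK (by linear_combination hKC)
    exact ((((incident_origin A).reach.trans (incident_second k A).reach.symm).trans
      (reach_quint_tri ..)).trans (reach_quad_tri ..).symm)
  obtain ⟨p, hp⟩ : ∃ p, (k * c - b ^ 3) * p = k * d ^ 2 + b * c - 2 * b ^ 2 * d :=
    ⟨_, mul_div_cancel₀ _ hKC⟩
  by_cases hw : p * k - b = 0
  · have hB : b = p * k := by linear_combination -hw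
    have hK : k ≠ 0 := by
      rintro rfl
      exact hne ⟨rfl, by rw [hB, mul_zero]⟩
    subst hB
    obtain rfl : d = p ^ 2 * k := by
      refine sub_eq_zero.1 ((pow_eq_zero_iff two_ne_zero).1 (mul_left_cancel₀ hK ?_))
      linear_combination -hp
    obtain ⟨e, he⟩ : ∃ e, k * e = p ^ 3 * k ^ 2 - c := ⟨_, mul_div_cancel₀ _ hK⟩
    have hI : Incident 0 0 0 0 e p (-e) 0 0 0 := ⟨by ring, by ring, by ring, by ring⟩
    have hJ : Incident k (p * k) c (p ^ 2 * k) (p ^ 3 * k + e) p (-e) 0 0 0 :=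
      ⟨by ring, by ring, by linear_combination he, by ring⟩
    exact (((reach_sibling ..).trans hI.reach).trans hJ.reach.symm).trans (reach_quint_quad ..)
  by_cases hq : p ^ 2 * k - 2 * p * b + d = 0
  · have hI : Incident k b c d (p ^ 3 * k - 3 * p ^ 2 * b + 3 * p * d) p 0 0 0 (p * k - b) := by
      refine ⟨by ring, by linear_combination hq, mul_left_cancel₀ hw ?_, rfl⟩
      obtain rfl : d = 2 * p * b - p ^ 2 * k := by linear_combination hq
      linear_combination hp
    exact (((incident_origin p).reach.trans (reach_sibling ..)).trans hI.reach.symm).trans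
      (reach_quint_quad ..)
  obtain ⟨δ, hδ⟩ : ∃ δ, (p * k - b) * δ = p ^ 2 * k - 2 * p * b + d :=
    ⟨_, mul_div_cancel₀ _ hw⟩
  obtain ⟨κ, hκ⟩ : ∃ κ, δ * κ = p * k - b := by
    refine ⟨_, mul_div_cancel₀ _ ?_⟩
    rintro rfl
    exact hq (by linear_combination -hδ)
  have hI := incident_third κ (p - δ) p
  rw [sub_sub_cancel] at hI
  have hJ : Incident k b c d (p ^ 3 * k - 3 * p ^ 2 * b + 3 * p * d - δ ^ 3 * κ) p
      (δ ^ 3 * κ) (-δ ^ 2 * κ) (-δ ^ 3 * κ ^ 2) (δ * κ) := by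
    refine ⟨by ring, by linear_combination -δ * hκ - hδ, mul_left_cancel₀ hw ?_, hκ⟩
    obtain rfl : d = (p * k - b) * δ - p ^ 2 * k + 2 * p * b := by linear_combination -hδ
    linear_combination hp - (p * k - b) * (δ * (δ * κ + (p * k - b)) + k * δ ^ 2) * hκ
  exact ((((incident_origin (p - δ)).reach.trans (incident_second κ _).reach.symm).trans
    hI.reach).trans hJ.reach.symm).trans (reach_quint_quad ..)

theorem reach_quint_quad_true_key {A f : K} (g h : K) (hne : ¬(A = 0 ∧ f = 0)) :
    Reach Edge 5 (quint true 0 0 0 0 0) (quad true A f g h) := by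
  by_cases hN : f ^ 2 + 3 * A * g * f + 3 * A ^ 2 * g ^ 2 + A ^ 3 * h = 0
  · have hA : A ≠ 0 := by
      rintro rfl
      exact hne ⟨rfl, (pow_eq_zero_iff two_ne_zero).1 (by linear_combination hN)⟩
    obtain ⟨M, hM⟩ : ∃ M, A ^ 2 * M = f + A * g := ⟨_, mul_div_cancel₀ _ (pow_ne_zero 2 hA)⟩
    obtain ⟨k, hk⟩ : ∃ k, A ^ 2 * k = -g - 2 * A * M :=
      ⟨_, mul_div_cancel₀ _ (pow_ne_zero 2 hA)⟩
    obtain rfl : g = -A ^ 2 * k - 2 * A * M := by linear_combination hk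
    obtain rfl : f = A ^ 3 * k + 3 * A ^ 2 * M := by linear_combination -hM
    have hI : Incident k (-M) 0 0 0 0 0 0 0 M := ⟨by ring, by ring, by ring, by ring⟩
    have hJ : Incident k (-M) 0 0 0 A (A ^ 3 * k + 3 * A ^ 2 * M) (-A ^ 2 * k - 2 * A * M) h
        (A * k + M) := by
      refine ⟨by ring, by ring, mul_left_cancel₀ (pow_ne_zero 3 hA) ?_, by ring⟩
      linear_combination hN
    exact (((reach_sibling ..).trans hI.reach.symm).trans hJ.reach).trans (reach_quint_quad ..)
  obtain ⟨k, hk⟩ : ∃ k, (f ^ 2 + 3 * A * g * f + 3 * A ^ 2 * g ^ 2 + A ^ 3 * h) * k =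
      h * f - g ^ 3 := ⟨_, mul_div_cancel₀ _ hN⟩
  by_cases hf : f - A ^ 3 * k = 0
  · obtain rfl : f = A ^ 3 * k := sub_eq_zero.1 hf
    obtain rfl : g = -(A ^ 2 * k) := by
      refine eq_neg_of_add_eq_zero_left ((pow_eq_zero_iff three_ne_zero).1 ?_)
      linear_combination hk
    have hI : Incident k 0 0 0 0 A (A ^ 3 * k) (-(A ^ 2 * k)) (-(A ^ 3 * k ^ 2)) (A * k) :=
      ⟨by ring, by ring, by ring, by ring⟩
    exact (((incident_origin' k).reach.symm.trans hI.reach).trans (reach_quint_tri ..)).trans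
      (reach_quad_tri ..).symm
  by_cases hu : g + A ^ 2 * k = 0
  · obtain rfl : g = -(A ^ 2 * k) := eq_neg_of_add_eq_zero_left hu
    have hI : Incident k 0 0 0 (A ^ 3 * k - f) A f (-(A ^ 2 * k)) h (A * k) := by
      refine ⟨by ring, by ring, mul_left_cancel₀ hf ?_, by ring⟩
      linear_combination -hk
    exact (((incident_origin' k).reach.symm.trans (reach_sibling ..)).trans hI.reach).trans
      (reach_quint_quad ..)
  obtain ⟨δ, hδ⟩ : ∃ δ, (g + A ^ 2 * k) * δ = -(f - A ^ 3 * k) := ⟨_, mul_div_cancel₀ _ hu⟩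
  have hδ₀ : δ ≠ 0 := by
    rintro rfl
    exact hf (by linear_combination hδ)
  obtain ⟨κ, hκ⟩ : ∃ κ, δ ^ 2 * κ = -(g + A ^ 2 * k) := ⟨_, mul_div_cancel₀ _ (pow_ne_zero 2 hδ₀)⟩
  obtain rfl : g = -(A ^ 2 * k) - δ ^ 2 * κ := by linear_combination hκ
  obtain rfl : f = A ^ 3 * k + δ ^ 3 * κ := by linear_combination hδ
  obtain ⟨p, rfl⟩ : ∃ p, A - p = δ := ⟨A - δ, sub_sub_cancel ..⟩
  have hI : Incident k 0 0 0 0 p (p ^ 3 * k) (-p ^ 2 * k) (-p ^ 3 * k ^ 2) (p * k) :=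
    ⟨by ring, by ring, by ring, by ring⟩
  have hJ : Incident (k + κ) (p * κ) (p ^ 3 * κ ^ 2) (p ^ 2 * κ) (p ^ 3 * κ) p (p ^ 3 * k)
      (-p ^ 2 * k) (-p ^ 3 * k ^ 2) (p * k) := ⟨by ring, by ring, by ring, by ring⟩
  have hL : Incident (k + κ) (p * κ) (p ^ 3 * κ ^ 2) (p ^ 2 * κ) (p ^ 3 * κ) A
      (A ^ 3 * k + (A - p) ^ 3 * κ) (-(A ^ 2 * k) - (A - p) ^ 2 * κ) h
      (A * (k + κ) - p * κ) := by
    refine ⟨by ring, by ring, mul_left_cancel₀ hf ?_, rfl⟩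
    linear_combination -hk
  exact ((((incident_origin' k).reach.symm.trans hI.reach).trans hJ.reach.symm).trans
    hL.reach).trans (reach_quint_quad ..)

theorem reach_quint_quad_of_ne (s : Bool) {x₁ x₂ z₁ z₂ : K} (x₃ x₄ x₅ z₃ z₄ : K)
    (hne : ¬(x₁ = z₁ ∧ x₂ = z₂)) :
    Reach Edge 5 (quint s x₁ x₂ x₃ x₄ x₅) (quad s z₁ z₂ z₃ z₄) := by
  cases s with
  | false =>
    refine reach_of_move (k := x₁) (b := x₂) (c := x₃) (d := x₄) (e := x₅) (t := 0)
      (reach_quint_quad_false_key (k := z₁ - x₁) (b := z₂ - x₂)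
        (z₃ - x₃ - 3 * (z₂ - x₂) * x₄ + (z₁ - x₁) * x₅) (z₄ - x₄) fun h => hne
          ⟨(sub_eq_zero.1 h.1).symm, (sub_eq_zero.1 h.2).symm⟩) ?_ ?_ <;>
    · simp only [move, translate, shear]
      congr 1 <;> ring
  | true =>
    refine reach_of_move (k := 0) (b := -x₅) (c := -x₄ + 3 * x₁ * x₅ ^ 2 + 3 * x₅ * x₃)
      (d := -2 * x₁ * x₅ - x₃) (e := -3 * x₁ ^ 2 * x₅ - 3 * x₁ * x₃ - x₂) (t := x₁)
      (reach_quint_quad_true_key (A := z₁ - x₁)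
        (f := z₂ - (3 * z₁ ^ 2 * x₅ + 3 * z₁ * (-2 * x₁ * x₅ - x₃)
          + 3 * x₁ ^ 2 * x₅ + 3 * x₁ * x₃ + x₂))
        (z₃ + 2 * z₁ * x₅ + (-2 * x₁ * x₅ - x₃))
        (z₄ - (-3 * z₁ * x₅ ^ 2 - 3 * x₅ * (-2 * x₁ * x₅ - x₃)
          - (-x₄ + 3 * x₁ * x₅ ^ 2 + 3 * x₅ * x₃))
          - 3 * x₅ * (z₃ + 2 * z₁ * x₅ + (-2 * x₁ * x₅ - x₃))) fun ⟨h₁, h₂⟩ => hne ?_) ?_ ?_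
    · obtain rfl := sub_eq_zero.1 h₁
      exact ⟨rfl, by linear_combination -h₂⟩
    · simp only [move, translate, shear]
      congr 1 <;> ring
    · simp only [move, translate, shear]
      congr 1 <;> ring

theorem reach_quad_quad_key (f g h : K) :
    Reach Edge 5 (quad false 0 0 0 0) (quad true 0 f g h) := by
  by_cases hg : g = 0
  · subst hg
    have hI : Incident 0 0 0 0 (-f) 0 f 0 0 0 := ⟨by ring, by ring, by ring, by ring⟩
    exact (((reach_quint_quad ..).symm.trans hI.reach).trans (reach_quint_tri ..)).trans
      (reach_quad_tri ..).symm
  by_cases hh : h = 0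
  · subst hh
    have hI : Incident 0 0 0 (-g) (-f) 0 f g 0 0 := ⟨by ring, by ring, by ring, by ring⟩
    exact (((reach_quad_tri ..).trans (reach_quint_tri ..).symm).trans hI.reach).trans
      (reach_quint_quad ..)
  obtain ⟨A, hA⟩ : ∃ A, h * A = g ^ 2 := ⟨_, mul_div_cancel₀ _ hh⟩
  have hA₀ : A ≠ 0 := by
    rintro rfl
    exact pow_ne_zero 2 hg (by linear_combination -hA)
  obtain ⟨k, rfl⟩ : ∃ k, -(A ^ 2 * k) = g := ⟨-g / A ^ 2, by
    rw [mul_div_cancel₀ _ (pow_ne_zero 2 hA₀), neg_neg]⟩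
  obtain rfl : h = A ^ 3 * k ^ 2 := mul_right_cancel₀ hA₀ (by linear_combination hA)
  obtain ⟨e, rfl⟩ : ∃ e, -e - A ^ 3 * k = f := ⟨-f - A ^ 3 * k, by ring⟩
  have hI : Incident 0 0 0 0 e A (-e) 0 0 0 := ⟨by ring, by ring, by ring, by ring⟩
  have hJ : Incident k (A * k) (A ^ 3 * k ^ 2 - k * e) (A ^ 2 * k) (A ^ 3 * k + e)
      A (-e) 0 0 0 := ⟨by ring, by ring, by ring, by ring⟩
  have hL : Incident k (A * k) (A ^ 3 * k ^ 2 - k * e) (A ^ 2 * k) (A ^ 3 * k + e)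
      0 (-e - A ^ 3 * k) (-(A ^ 2 * k)) (A ^ 3 * k ^ 2) (-(A * k)) :=
    ⟨by ring, by ring, by ring, by ring⟩
  exact ((((reach_quint_quad ..).symm.trans hI.reach).trans hJ.reach.symm).trans
    hL.reach).trans (reach_quint_quad ..)

theorem reach_quad_quad (k b c d a f g h : K) :
    Reach Edge 5 (quad false k b c d) (quad true a f g h) := by
  refine reach_of_move (k := k) (b := b) (c := c) (d := d) (e := 0) (t := a)
    (reach_quad_quad_key (f - (a ^ 3 * k - 3 * a ^ 2 * b + 3 * a * d))
      (g - (-a ^ 2 * k + 2 * a * b - d))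
      (h - (-a ^ 3 * k ^ 2 + 3 * a ^ 2 * k * b - 3 * a * b ^ 2 + 3 * b * d - c)
        - k * (f - (a ^ 3 * k - 3 * a ^ 2 * b + 3 * a * d))
        - 3 * (a * k - b) * (g - (-a ^ 2 * k + 2 * a * b - d)))) ?_ ?_ <;>
  · simp only [move, translate, shear]
    congr 1 <;> ring

end HexVertex

/-- The residues of size eight if `b`, and of size seven otherwise. -/
abbrev Slot (b : Bool) : Type := {c : Fin 8 // b = true ∨ c ≠ 7}

namespace Slot

variable {b : Bool}

/-- The slot congruent to `n` modulo seven. -/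
def ofNat (b : Bool) (n : ℕ) : Slot b :=
  ⟨⟨n % 7, by omega⟩, .inr fun h => by
    have := congrArg Fin.val h
    change n % 7 = 7 at this
    omega⟩

/-- The slot to which the `t`-th pendant vertex is attached. -/
def attach (b : Bool) (t : ZMod 13) : Slot b :=
  if h : b = true ∧ t.val = 7 then ⟨7, .inl h.1⟩ else ofNat b t.val

theorem exists_attach_eq : ∀ {b : Bool} (c : Slot b), ∃ t, attach b t = c := by
  decide

theorem card_links_le : ∀ (b : Bool) (c : Slot b),
    (Finset.univ.filter (· ≠ c)).card
      + ((Finset.univ.filter fun t => attach b t = c).card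
      + ((Finset.univ.filter fun d : ZMod 13 => d ≠ 0 ∧ ofNat b (d.val + 5) = c).card
      + ((Finset.univ.filter fun d : ZMod 13 => d ≠ 0 ∧ ofNat b (d.val + 3) = c).card
      + (Finset.univ.filter fun i : ZMod 13 => ofNat b (i.val + 2) = c).card))) ≤ 14 := by
  decide

theorem card_eq (b : Bool) : Fintype.card (Slot b) = if b then 8 else 7 := by
  cases b <;> decide

end Slot

/-- The size of a gadget: `(s, i, j)` is large on the `false` side away from `(0, 0)`. -/
def large (x : Bool × ZMod 13 × ZMod 13) : Bool := !x.1 && decide (x.2 ≠ (0, 0))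

/-- The vertices of the hexagon that remain, and those of the cliques `K₇` and `K₈` that replace
the deleted ones. -/
abbrev Vertex : Type :=
  HexVertex (ZMod 13) ⊕ ((x : Bool × ZMod 13 × ZMod 13) × Slot (large x))

namespace Vertex

open HexVertex

/-- The vertex of the clique at `x` with slot `c`. -/
abbrev hub (x : Bool × ZMod 13 × ZMod 13) (c : Slot (large x)) : Vertex := .inr ⟨x, c⟩

/-- The vertex of the clique at `x` whose slot is congruent to `n` modulo seven. -/
abbrev port (x : Bool × ZMod 13 × ZMod 13) (n : ℕ) : Vertex := hub x (.ofNat _ n)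

instance fact_prime_thirteen : Fact (Nat.Prime 13) := ⟨by norm_num⟩

/-- The edges of the graph, as a relation with symmetric closure. -/
inductive Link : Vertex → Vertex → Prop
  | hex {v w : HexVertex (ZMod 13)} (h : Edge v w) : Link (.inl v) (.inl w)
  | clique (x : Bool × ZMod 13 × ZMod 13) (c c' : Slot (large x)) (hc : c' ≠ c) :
      Link (hub x c) (hub x c')
  | attach (s : Bool) (i j t : ZMod 13) :
      Link (hub (s, i, j) (.attach _ t)) (.inl (tri s i j t))
  | column (s : Bool) (i j d : ZMod 13) (hd : d ≠ 0) :
      Link (port (s, i, j) (d.val + 5)) (port (s, i, j + d) ((-d).val + 5))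
  | row (s : Bool) (i j d : ZMod 13) (hd : d ≠ 0) :
      Link (port (s, i, j) (d.val + 3)) (port (s, i + d, j) ((-d).val + 3))
  | opposite (s : Bool) (i j i' : ZMod 13) :
      Link (port (s, i, j) (i'.val + 2)) (port (!s, i', j) (i.val + 2))

theorem reach_hex {n : ℕ} {v w : HexVertex (ZMod 13)} (h : Reach Edge n v w) :
    Reach Link n (.inl v) (.inl w) :=
  h.map _ fun _ _ => .hex

theorem reach_clique (x : Bool × ZMod 13 × ZMod 13) (c c' : Slot (large x)) :
    Reach Link 1 (hub x c) (hub x c') := by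
  by_cases hc : c' = c
  · exact hc ▸ .refl _ _
  · exact .of_rel (.clique x c c' hc)

theorem reach_column (s : Bool) (i j j' : ZMod 13) (c : Slot (large (s, i, j)))
    (c' : Slot (large (s, i, j'))) : Reach Link 3 (hub (s, i, j) c) (hub (s, i, j') c') := by
  by_cases hj : j' = j
  · subst hj
    exact (reach_clique ..).mono (by decide)
  · have h := Link.column s i j (j' - j) (sub_ne_zero.2 hj)
    rw [add_sub_cancel] at h
    exact ((reach_clique ..).trans (.of_rel h)).trans (reach_clique ..)

theorem reach_hub_hub (x y : Bool × ZMod 13 × ZMod 13) (c : Slot (large x)) (c' : Slot (large y)) :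
    Reach Link 5 (hub x c) (hub y c') := by
  obtain ⟨s, i, j⟩ := x
  obtain ⟨s', i', j'⟩ := y
  obtain rfl | rfl := Bool.eq_or_eq_not s' s
  · by_cases hi : i' = i
    · subst hi
      exact (reach_column ..).mono (by decide)
    · have h := Link.row s' i j (i' - i) (sub_ne_zero.2 hi)
      rw [add_sub_cancel] at h
      exact ((reach_clique ..).trans (.of_rel h)).trans (reach_column ..)
  · exact ((reach_clique ..).trans (.of_rel (.opposite s i j i'))).trans (reach_column ..)

theorem exists_reach_hub_tri (s : Bool) (i j : ZMod 13) (c : Slot (large (s, i, j))) :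
    ∃ t, Reach Link 1 (hub (s, i, j) c) (.inl (tri s i j t)) := by
  obtain ⟨t, rfl⟩ := Slot.exists_attach_eq c
  exact ⟨t, .of_rel (.attach s i j t)⟩

theorem reach_hub_tri_column (s : Bool) (i j j' t : ZMod 13) (c : Slot (large (s, i, j))) :
    Reach Link 4 (hub (s, i, j) c) (.inl (tri s i j' t)) :=
  (reach_column ..).trans (.of_rel (.attach s i j' t))

theorem reach_tri_hub (s : Bool) (i j t : ZMod 13) (c : Slot (large (s, i, j))) :
    Reach Link 2 (.inl (tri s i j t)) (hub (s, i, j) c) :=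
  (Reach.of_rel (.attach s i j t)).symm.trans (reach_clique ..)

theorem reach_tri_tri_clique (s : Bool) (i j t t' : ZMod 13) :
    Reach Link 3 (.inl (tri s i j t)) (.inl (tri s i j t')) :=
  (reach_tri_hub ..).trans (.of_rel (.attach s i j t'))

theorem reach_tri_tri_column (s : Bool) (i j j' t t' : ZMod 13) :
    Reach Link 5 (.inl (tri s i j t)) (.inl (tri s i j' t')) :=
  (Reach.of_rel (.attach s i j t)).symm.trans (reach_hub_tri_column ..)

theorem reach_hub_hex (x : Bool × ZMod 13 × ZMod 13) (c : Slot (large x))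
    (v : HexVertex (ZMod 13)) : Reach Link 6 (hub x c) (.inl v) := by
  obtain ⟨s, i, j⟩ := x
  cases v with
  | tri s' z₁ z₂ z₃ => exact (reach_hub_hub ..).trans (.of_rel (.attach s' z₁ z₂ z₃))
  | quad s' z₁ z₂ z₃ z₄ =>
    obtain rfl | rfl := Bool.eq_or_eq_not s' s
    · by_cases hi : i = z₁
      · subst hi
        exact ((reach_hub_tri_column ..).trans (reach_hex (reach_quad_tri ..).symm)).mono
          (by decide)
      · obtain ⟨t, ht⟩ := exists_reach_hub_tri s' i j c
        exact ht.trans (reach_hex (HexVertex.reach_tri_quad s' i j t z₁ z₂ z₃ z₄ hi))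
    · obtain ⟨t, ht⟩ := exists_reach_tri_quad s i j z₁ z₂ z₃ z₄
      exact (reach_tri_hub s i j t c).symm.trans (reach_hex ht)
  | quint s' z₁ z₂ z₃ z₄ z₅ =>
    obtain rfl | rfl := Bool.eq_or_eq_not s' s
    · by_cases hi : i = z₁
      · subst hi
        exact (reach_hub_tri_column ..).trans (reach_hex (reach_quint_tri ..).symm)
      · obtain ⟨t, ht⟩ := exists_reach_tri_quint s' i j z₁ z₂ z₃ z₄ z₅ hi
        exact (reach_tri_hub s' i j t c).symm.trans (reach_hex ht)
    · obtain ⟨t, ht⟩ := exists_reach_hub_tri s i j c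
      obtain ⟨t', ht'⟩ | h := HexVertex.reach_tri_quint s i j t z₁ z₂ z₃ z₄ z₅
      · exact ((reach_tri_hub s i j t' c).symm.trans (reach_hex ht')).mono (by decide)
      · exact ht.trans (reach_hex h)

theorem reach_tri_hex (s : Bool) (i j t : ZMod 13) (v : HexVertex (ZMod 13)) :
    Reach Link 6 (.inl (tri s i j t)) (.inl v) := by
  cases v with
  | tri s' z₁ z₂ z₃ =>
    obtain rfl | rfl := Bool.eq_or_eq_not s' s
    · by_cases hi : i = z₁
      · subst hi
        exact (reach_tri_tri_column ..).mono (by decide)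
      · exact reach_hex ((HexVertex.reach_tri_quad s' i j t z₁ z₂ z₃ 0 hi).trans
          (reach_quad_tri ..))
    · cases s
      · exact (reach_hex (reach_tri_tri ..)).mono (by decide)
      · exact (reach_hex (reach_tri_tri ..).symm).mono (by decide)
  | quad s' z₁ z₂ z₃ z₄ =>
    obtain rfl | rfl := Bool.eq_or_eq_not s' s
    · by_cases hi : i = z₁
      · subst hi
        exact (reach_tri_tri_column ..).trans (reach_hex (reach_quad_tri ..).symm)
      · exact (reach_hex (HexVertex.reach_tri_quad s' i j t z₁ z₂ z₃ z₄ hi)).mono (by decide)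
    · cases s
      · exact reach_hex ((reach_tri_tri ..).trans (reach_quad_tri ..).symm)
      · exact reach_hex ((reach_tri_tri ..).symm.trans (reach_quad_tri ..).symm)
  | quint s' z₁ z₂ z₃ z₄ z₅ =>
    obtain rfl | rfl := Bool.eq_or_eq_not s' s
    · by_cases h : z₁ = i ∧ z₂ = j
      · obtain ⟨rfl, rfl⟩ := h
        exact ((reach_tri_tri_clique ..).trans (reach_hex (reach_quint_tri ..).symm)).mono
          (by decide)
      · exact reach_hex ((reach_quint_quad_of_ne s' z₃ z₄ z₅ t 0 h).trans
          (reach_quad_tri ..)).symm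
    · obtain ⟨t', ht'⟩ | h := HexVertex.reach_tri_quint s i j t z₁ z₂ z₃ z₄ z₅
      · exact (reach_tri_tri_clique ..).trans (reach_hex ht')
      · exact (reach_hex h).mono (by decide)

theorem exists_reach_quint (s : Bool) (x₁ x₂ x₃ x₄ x₅ : ZMod 13) : ∃ y₁ y₂ y₃ y₄ y₅,
    Reach Edge 1 (quint s x₁ x₂ x₃ x₄ x₅) (quint (!s) y₁ y₂ y₃ y₄ y₅) := by
  cases s
  · obtain ⟨f, g, h, m, hI⟩ := exists_incident_true x₁ x₂ x₃ x₄ x₅ 0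
    exact ⟨_, _, _, _, _, hI.reach⟩
  · exact ⟨_, _, _, _, _, (incident_false 0 x₁ x₂ x₃ x₄ x₅).reach.symm⟩

theorem reach_quint_quint_not (s : Bool) (x₁ x₂ x₃ x₄ x₅ y₁ y₂ y₃ y₄ y₅ : ZMod 13) :
    Reach Edge 5 (quint s x₁ x₂ x₃ x₄ x₅) (quint (!s) y₁ y₂ y₃ y₄ y₅) := by
  cases s
  · exact HexVertex.reach_quint_quint ..
  · exact (HexVertex.reach_quint_quint ..).symm

theorem reach_quad_quint (s s' : Bool) (x₁ x₂ x₃ x₄ y₁ y₂ y₃ y₄ y₅ : ZMod 13) :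
    Reach Link 6 (.inl (quad s x₁ x₂ x₃ x₄)) (.inl (quint s' y₁ y₂ y₃ y₄ y₅)) := by
  obtain rfl | rfl := Bool.eq_or_eq_not s' s
  · by_cases h : y₁ = x₁ ∧ y₂ = x₂
    · obtain ⟨rfl, rfl⟩ := h
      exact ((reach_hex (reach_quad_tri ..)).trans (reach_tri_tri_clique ..)).trans
        (reach_hex (reach_quint_tri ..).symm)
    · exact (reach_hex (reach_quint_quad_of_ne s' y₃ y₄ y₅ x₃ x₄ h).symm).mono (by decide)
  · exact reach_hex ((reach_quint_quad s x₁ x₂ x₃ x₄ 0).symm.trans (reach_quint_quint_not ..))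

theorem reach_hex_hex (v w : HexVertex (ZMod 13)) : Reach Link 6 (.inl v) (.inl w) := by
  cases v with
  | tri => exact reach_tri_hex ..
  | quad s x₁ x₂ x₃ x₄ =>
    cases w with
    | tri => exact (reach_tri_hex ..).symm
    | quint => exact reach_quad_quint ..
    | quad s' y₁ y₂ y₃ y₄ =>
      obtain rfl | rfl := Bool.eq_or_eq_not s' s
      · by_cases h : x₁ = y₁ ∧ x₂ = y₂
        · obtain ⟨rfl, rfl⟩ := h
          exact (((reach_hex (reach_quad_tri ..)).trans (reach_tri_tri_clique ..)).trans
            (reach_hex (reach_quad_tri ..).symm)).mono (by decide)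
        · exact reach_hex ((reach_quint_quad s' x₁ x₂ x₃ x₄ 0).symm.trans
            (reach_quint_quad_of_ne s' x₃ x₄ 0 y₃ y₄ h))
      · cases s
        · exact (reach_hex (reach_quad_quad ..)).mono (by decide)
        · exact (reach_hex (reach_quad_quad ..).symm).mono (by decide)
  | quint s x₁ x₂ x₃ x₄ x₅ =>
    cases w with
    | tri => exact (reach_tri_hex ..).symm
    | quad => exact (reach_quad_quint ..).symm
    | quint s' y₁ y₂ y₃ y₄ y₅ =>
      obtain rfl | rfl := Bool.eq_or_eq_not s' s
      · obtain ⟨z₁, z₂, z₃, z₄, z₅, h⟩ := exists_reach_quint s' y₁ y₂ y₃ y₄ y₅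
        exact reach_hex ((reach_quint_quint_not ..).trans h.symm)
      · exact (reach_hex (reach_quint_quint_not ..)).mono (by decide)

/-- Any two vertices are at distance at most six. -/
theorem reach_six : ∀ v w : Vertex, Reach Link 6 v w
  | .inl v, .inl w => reach_hex_hex v w
  | .inl v, .inr ⟨x, c⟩ => (reach_hub_hex x c v).symm
  | .inr ⟨x, c⟩, .inl w => reach_hub_hex x c w
  | .inr ⟨x, c⟩, .inr ⟨y, c'⟩ => (reach_hub_hub x y c c').mono (by decide)

/-- The vertices linked to `v`, in either orientation. -/
def neighbors (v : Vertex) : Set Vertex := {w | Link v w ∨ Link w v}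

theorem encard_le_of_subset_insert {S : Set Vertex} (a : Vertex) (f : ZMod 13 → Vertex)
    (h : S ⊆ insert a (Set.range f)) : S.encard ≤ 14 :=
  calc S.encard ≤ (insert a (Set.range f)).encard := Set.encard_le_encard h
    _ ≤ (Set.range f).encard + 1 := Set.encard_insert_le _ _
    _ ≤ 13 + 1 := by
      gcongr
      rw [← Set.image_univ]
      refine (Set.encard_image_le _ _).trans ?_
      rw [Set.encard_univ, ENat.card_eq_coe_fintype_card, ZMod.card]
      rfl
    _ = 14 := by norm_num

open Classical in
theorem encard_neighbors_hub_le (x : Bool × ZMod 13 × ZMod 13) (c : Slot (large x)) :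
    (neighbors (hub x c)).encard ≤ 14 := by
  obtain ⟨s, i, j⟩ := x
  have hsub : neighbors (hub (s, i, j) c) ⊆
      ↑((Finset.univ.filter (· ≠ c)).image (hub (s, i, j))
        ∪ ((Finset.univ.filter fun t => Slot.attach _ t = c).image
            (fun t => (.inl (tri s i j t) : Vertex))
        ∪ ((Finset.univ.filter fun d : ZMod 13 => d ≠ 0 ∧ .ofNat _ (d.val + 5) = c).image
            (fun d => port (s, i, j + d) ((-d).val + 5))
        ∪ ((Finset.univ.filter fun d : ZMod 13 => d ≠ 0 ∧ .ofNat _ (d.val + 3) = c).image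
            (fun d => port (s, i + d, j) ((-d).val + 3))
        ∪ (Finset.univ.filter fun i' : ZMod 13 => .ofNat _ (i'.val + 2) = c).image
            (fun i' => port (!s, i', j) (i.val + 2))))) : Finset Vertex) := by
    simp only [Finset.coe_union, Finset.coe_image, Finset.coe_filter, Finset.mem_univ, true_and]
    rintro w (h | h)
    · cases h with
      | clique _ _ c' hc => exact .inl ⟨c', hc, rfl⟩
      | attach _ _ _ t => exact .inr (.inl ⟨t, rfl, rfl⟩)
      | column _ _ _ d hd => exact .inr (.inr (.inl ⟨d, ⟨hd, rfl⟩, rfl⟩))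
      | row _ _ _ d hd => exact .inr (.inr (.inr (.inl ⟨d, ⟨hd, rfl⟩, rfl⟩)))
      | opposite _ _ _ i' => exact .inr (.inr (.inr (.inr ⟨i', rfl, rfl⟩)))
    · cases h with
      | clique _ c' _ hc => exact .inl ⟨c', hc.symm, rfl⟩
      | column _ _ j₀ d hd =>
        refine .inr (.inr (.inl ⟨-d, ⟨neg_ne_zero.2 hd, rfl⟩, ?_⟩))
        simp only [add_neg_cancel_right, neg_neg]
      | row _ i₀ _ d hd =>
        refine .inr (.inr (.inr (.inl ⟨-d, ⟨neg_ne_zero.2 hd, rfl⟩, ?_⟩)))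
        simp only [add_neg_cancel_right, neg_neg]
      | opposite s₀ i₀ =>
        refine .inr (.inr (.inr (.inr ⟨i₀, rfl, ?_⟩)))
        simp only [Bool.not_not]
  refine (Set.encard_le_encard hsub).trans ?_
  rw [Set.encard_coe_eq_coe_finsetCard]
  exact_mod_cast ((Finset.card_union_le _ _).trans (add_le_add Finset.card_image_le
    ((Finset.card_union_le _ _).trans (add_le_add Finset.card_image_le
    ((Finset.card_union_le _ _).trans (add_le_add Finset.card_image_le
    ((Finset.card_union_le _ _).trans (add_le_add Finset.card_image_le
      Finset.card_image_le)))))))).trans (Slot.card_links_le (large (s, i, j)) c)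

theorem encard_neighbors_le (v : Vertex) : (neighbors v).encard ≤ 14 := by
  obtain (⟨s, x₁, x₂, x₃⟩ | ⟨s, x₁, x₂, x₃, x₄⟩ | ⟨s, x₁, x₂, x₃, x₄, x₅⟩) | ⟨x, c⟩ := v
  case inl.tri =>
    refine encard_le_of_subset_insert (hub (s, x₁, x₂) (.attach _ x₃))
      (fun t => .inl (quad s x₁ x₂ x₃ t)) ?_
    rintro w (h | h)
    · cases h with | hex h => cases h
    · cases h with
      | hex h =>
        cases h
        exact .inr ⟨_, rfl⟩
      | attach => exact .inl rfl
  case inl.quad =>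
    refine encard_le_of_subset_insert (.inl (tri s x₁ x₂ x₃))
      (fun t => .inl (quint s x₁ x₂ x₃ x₄ t)) ?_
    rintro w (h | h)
    · cases h with
      | hex h =>
        cases h
        exact .inl rfl
    · cases h with
      | hex h =>
        cases h
        exact .inr ⟨_, rfl⟩
  case inl.quint =>
    cases s with
    | false =>
      choose f g h m hI using exists_incident_true x₁ x₂ x₃ x₄ x₅
      refine encard_le_of_subset_insert (.inl (quad false x₁ x₂ x₃ x₄))
        (fun a => .inl (quint true a (f a) (g a) (h a) (m a))) ?_
      rintro w (h | h)
      · cases h with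
        | hex h =>
          cases h with
          | quint => exact .inl rfl
          | @cross _ _ _ _ _ a _ _ _ _ hJ =>
            obtain ⟨rfl, rfl, rfl, rfl⟩ := hJ
            obtain ⟨h₁, h₂, h₃, h₄⟩ := hI a
            exact .inr ⟨a, by simp only [h₁, h₂, h₃, h₄]⟩
      · cases h with | hex h => cases h
    | true =>
      choose b c d e hI using fun k => exists_incident_false k x₁ x₂ x₃ x₄ x₅
      refine encard_le_of_subset_insert (.inl (quad true x₁ x₂ x₃ x₄))
        (fun k => .inl (quint false k (b k) (c k) (d k) (e k))) ?_
      rintro w (h | h)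
      · cases h with
        | hex h =>
          cases h
          exact .inl rfl
      · cases h with
        | hex h =>
          cases h with
          | @cross k _ _ _ _ _ _ _ _ _ hJ =>
            obtain ⟨h₁, h₂, h₃, h₄⟩ := (hI k).eq_of_incident hJ
            exact .inr ⟨k, by simp only [h₁, h₂, h₃, h₄]⟩
  case inr => exact encard_neighbors_hub_le x c

theorem card_eq : Nat.card Vertex = 806636 := by
  let e : HexVertex (ZMod 13) ≃ (Bool × ZMod 13 × ZMod 13 × ZMod 13) ⊕
      (Bool × ZMod 13 × ZMod 13 × ZMod 13 × ZMod 13) ⊕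
      (Bool × ZMod 13 × ZMod 13 × ZMod 13 × ZMod 13 × ZMod 13) :=
    { toFun
        | tri s x₁ x₂ x₃ => .inl (s, x₁, x₂, x₃)
        | quad s x₁ x₂ x₃ x₄ => .inr (.inl (s, x₁, x₂, x₃, x₄))
        | quint s x₁ x₂ x₃ x₄ x₅ => .inr (.inr (s, x₁, x₂, x₃, x₄, x₅))
      invFun
        | .inl (s, x₁, x₂, x₃) => tri s x₁ x₂ x₃
        | .inr (.inl (s, x₁, x₂, x₃, x₄)) => quad s x₁ x₂ x₃ x₄
        | .inr (.inr (s, x₁, x₂, x₃, x₄, x₅)) => quint s x₁ x₂ x₃ x₄ x₅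
      left_inv := by rintro (_ | _ | _) <;> rfl
      right_inv := by rintro (_ | _ | _) <;> rfl }
  have hhub : ∑ x, Fintype.card (Slot (large x)) = 2534 := by
    simp only [Slot.card_eq]
    decide +kernel
  rw [Nat.card_congr (e.sumCongr (Equiv.refl _)), Nat.card_eq_fintype_card]
  simp only [Fintype.card_sum, Fintype.card_prod, Fintype.card_sigma, Fintype.card_bool,
    ZMod.card, hhub]

end Vertex

/-- There exists a connected finite simple graph with exactly 806636 vertices,
maximum degree at most 14, and diameter at most 6. -/
theorem exists_connected_graph_card_806636_maxDegree_le_14_diam_le_6 :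
    ∃ G : SimpleGraph (Fin 806636), G.Connected ∧
      (∀ v : Fin 806636, (G.neighborSet v).ncard ≤ 14) ∧ G.diam ≤ 6 := by
  have : Finite Vertex := Nat.finite_of_card_ne_zero (by rw [Vertex.card_eq]; decide)
  let e : Vertex ≃ Fin 806636 := Finite.equivFinOfCardEq Vertex.card_eq
  let r : Fin 806636 → Fin 806636 → Prop := fun a b => Vertex.Link (e.symm a) (e.symm b)
  have hwalk (a b) : ∃ p : (SimpleGraph.fromRel r).Walk a b, p.length ≤ 6 := by
    have h := (Vertex.reach_six (e.symm a) (e.symm b)).map (r' := r) e fun x y h => by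
      simpa only [r, Equiv.symm_apply_apply] using h
    simp only [Equiv.apply_symm_apply] at h
    exact h.exists_walk
  refine ⟨.fromRel r, ⟨fun a b => (hwalk a b).elim fun p _ => ⟨p⟩⟩, fun v => ?_, ?_⟩
  · have hsub : e.symm '' (SimpleGraph.fromRel r).neighborSet v ⊆
        Vertex.neighbors (e.symm v) := by
      rintro _ ⟨w, hw, rfl⟩
      exact hw.2
    rw [← Set.ncard_image_of_injective _ e.symm.injective]
    exact ENat.toNat_le_of_le_natCast
      ((Set.encard_le_encard hsub).trans (Vertex.encard_neighbors_le _))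
  · refine ENat.toNat_le_of_le_natCast (SimpleGraph.ediam_le_of_edist_le fun a b => ?_)
    obtain ⟨p, hp⟩ := hwalk a b
    exact p.edist_le.trans (by exact_mod_cast hp)
end

section
/- Let G be a bipartite Moore graph of degree Δ ≥ 3 and diameter D, that is, a connected bipartite Δ-regular finite simple graph of diameter D whose number of vertices equals 2((Δ−1)^D − 1)/(Δ−2). Then for any two vertices x and y with distance d(x,y) = D, there exist Δ pairwise internally vertex-disjoint paths between x and y, each of length exactly D. -/
namespace SimpleGraph

variable {V : Type*} {G : SimpleGraph V}

lemma Coloring.dist_ne_of_adj (c : G.Coloring Bool) (hG : G.Connected) (v : V) {u w : V}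
    (h : G.Adj u w) : G.dist v u ≠ G.dist v w := by
  intro he
  obtain ⟨p, hp⟩ := hG.exists_walk_length_eq_dist v u
  obtain ⟨q, hq⟩ := hG.exists_walk_length_eq_dist v w
  have h1 := c.even_length_iff_congr p
  have h2 := c.even_length_iff_congr q
  have h3 := c.valid h
  rw [hp, he, ← hq] at h1
  rw [h1] at h2
  revert h2 h3
  cases c v <;> cases c u <;> cases c w <;> simp

lemma Coloring.dist_succ_of_adj (c : G.Coloring Bool) (hG : G.Connected) (v : V) {u w : V}
    (h : G.Adj u w) : G.dist v u + 1 = G.dist v w ∨ G.dist v w + 1 = G.dist v u := by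
  have h1 := c.dist_ne_of_adj hG v h
  have h2 := h.diff_dist_adj (u := v)
  omega

open Classical in
/-- The vertices at distance `k` from `v`. -/
noncomputable def distLayer [Fintype V] (G : SimpleGraph V) (v : V) (k : ℕ) : Finset V :=
  {u | G.dist v u = k}

open Classical in
/-- The number of edges between the vertices at distance `k` and those at distance `k + 1`
from `v`. -/
noncomputable def layerEdges [Fintype V] (G : SimpleGraph V) (v : V) (k : ℕ) : ℕ :=
  ∑ u ∈ G.distLayer v (k + 1), (Finset.bipartiteBelow G.Adj (G.distLayer v k) u).card

section Counting

variable [Fintype V]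

@[simp]
lemma mem_distLayer {v u : V} {k : ℕ} : u ∈ G.distLayer v k ↔ G.dist v u = k := by
  simp [distLayer]

lemma Connected.distLayer_zero (hG : G.Connected) (v : V) : G.distLayer v 0 = {v} := by
  ext u
  simp [hG.dist_eq_zero_iff, eq_comm]

open Classical in
lemma layerEdges_eq_sum (v : V) (k : ℕ) : G.layerEdges v k =
    ∑ u ∈ G.distLayer v k, (Finset.bipartiteAbove G.Adj (G.distLayer v (k + 1)) u).card :=
  (Finset.sum_card_bipartiteAbove_eq_sum_card_bipartiteBelow _).symm

open Classical in
lemma Connected.one_le_card_bipartiteBelow (hG : G.Connected) {v u : V} {k : ℕ}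
    (hu : u ∈ G.distLayer v (k + 1)) :
    1 ≤ (Finset.bipartiteBelow G.Adj (G.distLayer v k) u).card := by
  rw [mem_distLayer] at hu
  obtain ⟨p, hp⟩ := hG.exists_walk_length_eq_dist u v
  rw [G.dist_comm, hu] at hp
  cases p with
  | nil => simp at hp
  | @cons _ w _ h p =>
    refine Finset.card_pos.2 ⟨w, ?_⟩
    simp only [Walk.length_cons, add_left_inj] at hp
    have h1 : G.dist w v ≤ k := hp ▸ dist_le p
    rw [G.dist_comm] at h1
    simp only [Finset.mem_bipartiteBelow, mem_distLayer]
    refine ⟨?_, h.symm⟩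
    have h3 := hG.dist_triangle (u := v) (v := w) (w := u)
    have h4 := dist_eq_one_iff_adj.2 h.symm
    omega

lemma Connected.card_distLayer_succ_le (hG : G.Connected) (v : V) (k : ℕ) :
    (G.distLayer v (k + 1)).card ≤ G.layerEdges v k := by
  rw [Finset.card_eq_sum_ones]
  exact Finset.sum_le_sum fun u hu => hG.one_le_card_bipartiteBelow hu

lemma Coloring.layerEdges_add_layerEdges_succ [DecidableRel G.Adj] (c : G.Coloring Bool)
    (hG : G.Connected) {d : ℕ} (hreg : G.IsRegularOfDegree d) (v : V) (k : ℕ) :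
    G.layerEdges v k + G.layerEdges v (k + 1) = d * (G.distLayer v (k + 1)).card := by
  classical
  rw [layerEdges_eq_sum v (k + 1), layerEdges, ← Finset.sum_add_distrib, mul_comm,
    ← smul_eq_mul, ← Finset.sum_const]
  refine Finset.sum_congr rfl fun u hu => ?_
  rw [mem_distLayer] at hu
  rw [← hreg u, ← card_neighborFinset_eq_degree, ← Finset.card_union_of_disjoint]
  · congr 1
    ext w
    simp only [Finset.mem_union, Finset.mem_bipartiteBelow, Finset.mem_bipartiteAbove,
      mem_distLayer, mem_neighborFinset]
    constructor
    · rintro (h | h)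
      exacts [h.2.symm, h.2]
    · intro h
      have := c.dist_succ_of_adj hG v h
      rcases this with h1 | h1
      · exact Or.inr ⟨by omega, h⟩
      · exact Or.inl ⟨by omega, h.symm⟩
  · rw [Finset.disjoint_left]
    intro w h1 h2
    simp only [Finset.mem_bipartiteBelow, Finset.mem_bipartiteAbove, mem_distLayer] at h1 h2
    omega

lemma Coloring.layerEdges_le [DecidableRel G.Adj] (c : G.Coloring Bool)
    (hG : G.Connected) {q : ℕ} (hreg : G.IsRegularOfDegree (q + 1)) (v : V) (k : ℕ) :
    G.layerEdges v k ≤ (q + 1) * q ^ k := by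
  classical
  induction k with
  | zero =>
    rw [layerEdges_eq_sum, hG.distLayer_zero, Finset.sum_singleton, pow_zero, mul_one,
      ← hreg v, ← card_neighborFinset_eq_degree]
    refine Finset.card_le_card fun w hw => ?_
    simp only [Finset.mem_bipartiteAbove] at hw
    exact (mem_neighborFinset ..).2 hw.2
  | succ k ih =>
    have h1 := c.layerEdges_add_layerEdges_succ hG hreg v k
    have h2 := Nat.mul_le_mul_left (q + 1) (hG.card_distLayer_succ_le v k)
    have h3 := Nat.mul_le_mul_left q ih
    have h4 : (q + 1) * q ^ (k + 1) = q * ((q + 1) * q ^ k) := by ring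
    have h5 : (q + 1) * G.layerEdges v k = q * G.layerEdges v k + G.layerEdges v k := by ring
    omega

/-- In a graph attaining the bipartite Moore bound for diameter `m + 1`, every vertex at distance
`k + 1 ≤ m` from `v` has a single neighbour at distance `k` from `v`. -/
lemma Coloring.eq_of_adj_of_dist_of_card_eq [DecidableRel G.Adj] (c : G.Coloring Bool)
    (hG : G.Connected) {q m : ℕ} (hreg : G.IsRegularOfDegree (q + 1))
    (hdist : ∀ u v, G.dist u v ≤ m + 1)
    (hcard : Fintype.card V = 2 * ∑ k ∈ Finset.range (m + 1), q ^ k)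
    {v u z z' : V} {k : ℕ} (hk : k < m) (hu : G.dist v u = k + 1)
    (hz : G.dist v z = k) (hzu : G.Adj z u) (hz' : G.dist v z' = k) (hzu' : G.Adj z' u) :
    z = z' := by
  classical
  have hlast : (G.distLayer v (m + 1)).card ≤ q ^ m := by
    have h1 := c.layerEdges_add_layerEdges_succ hG hreg v m
    have h2 := c.layerEdges_le hG hreg v m
    have h3 : G.layerEdges v (m + 1) = 0 := by
      refine Finset.sum_eq_zero_iff.2 fun u hu => ?_
      have := hdist v u
      rw [mem_distLayer] at hu
      omega
    rw [h3, add_zero] at h1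
    exact Nat.le_of_mul_le_mul_left (h1 ▸ h2) q.succ_pos
  have htotal : Fintype.card V = ∑ j ∈ Finset.range (m + 2), (G.distLayer v j).card := by
    rw [← Finset.card_univ, Finset.card_eq_sum_card_fiberwise (f := G.dist v)
      (t := Finset.range (m + 2))]
    · rfl
    · intro u _
      have := hdist v u
      simp only [Finset.coe_range, Set.mem_Iio]
      omega
  rw [Finset.sum_range_succ, Finset.sum_range_succ', hG.distLayer_zero, Finset.card_singleton,
    hcard] at htotal
  have hbound : ∑ j ∈ Finset.range m, G.layerEdges v j ≤
      ∑ j ∈ Finset.range m, (q ^ (j + 1) + q ^ j) :=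
    Finset.sum_le_sum fun j _ => (c.layerEdges_le hG hreg v j).trans_eq (by ring)
  have hle : ∀ j ∈ Finset.range m, (G.distLayer v (j + 1)).card ≤ G.layerEdges v j :=
    fun j _ => hG.card_distLayer_succ_le v j
  have h1 := Finset.sum_range_succ' (fun j => q ^ j) m
  have h2 := Finset.sum_range_succ (fun j => q ^ j) m
  rw [Finset.sum_add_distrib] at hbound
  have hsum : ∑ j ∈ Finset.range m, (G.distLayer v (j + 1)).card =
      ∑ j ∈ Finset.range m, G.layerEdges v j :=
    le_antisymm (Finset.sum_le_sum hle) (by simp only [pow_zero] at h1; omega)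
  have heq := (Finset.sum_eq_sum_iff_of_le hle).1 hsum k (Finset.mem_range.2 hk)
  rw [Finset.card_eq_sum_ones, layerEdges] at heq
  have hone := (Finset.sum_eq_sum_iff_of_le
    fun u hu => hG.one_le_card_bipartiteBelow hu).1 heq u (mem_distLayer.2 hu)
  refine Finset.card_le_one.1 hone.ge z ?_ z' ?_ <;> simp [*]

end Counting

lemma Connected.dist_add_dist_eq_of_mem_support (hG : G.Connected) {x y z v : V} {n : ℕ}
    (hxy : G.dist x y = n + 1) (h : G.Adj z y) (p : G.Walk x z) (hp : p.length = n)
    (hv : v ∈ p.support) :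
    G.dist v y = G.dist v z + 1 ∧ G.dist x v + G.dist v z = n := by
  classical
  have h1 := congrArg Walk.length (p.take_spec hv)
  rw [Walk.length_append] at h1
  have h2 := dist_le (p.takeUntil v hv)
  have h3 := dist_le (p.dropUntil v hv)
  have h4 := hG.dist_triangle (u := v) (v := z) (w := y)
  have h5 := hG.dist_triangle (u := x) (v := v) (w := y)
  have h6 := dist_eq_one_iff_adj.2 h
  omega

end SimpleGraph


/-- In a bipartite Moore graph of degree Δ ≥ 3 and diameter D, any two vertices
at distance D are joined by Δ pairwise internally vertex-disjoint paths of
length exactly D. -/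
theorem bipartite_moore_graph_disjoint_paths {V : Type*} [Fintype V]
    (G : SimpleGraph V) [DecidableRel G.Adj] (hG : G.Connected)
    (V1 V2 : Set V) (hdisj : Disjoint V1 V2) (hunion : V1 ∪ V2 = Set.univ)
    (hbip : ∀ u v : V, G.Adj u v → (u ∈ V1 ∧ v ∈ V2) ∨ (u ∈ V2 ∧ v ∈ V1))
    (Δ D : ℕ) (hΔ : 3 ≤ Δ)
    (hreg : G.IsRegularOfDegree Δ) (hdiam : G.diam = D)
    (hcard : Fintype.card V = 2 * ((Δ - 1) ^ D - 1) / (Δ - 2)) :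
    ∀ x y : V, G.dist x y = D →
      ∃ p : Fin Δ → G.Walk x y,
        (∀ i, (p i).IsPath ∧ (p i).length = D) ∧
        (∀ i j, i ≠ j → ∀ v : V,
          v ∈ (p i).support → v ∈ (p j).support → v = x ∨ v = y) := by
  classical
  intro x y hxy
  obtain ⟨q, rfl⟩ : ∃ q, Δ = q + 1 := ⟨Δ - 1, by omega⟩
  have hle : ∀ u v, G.dist u v ≤ D := fun u v =>
    hdiam ▸ SimpleGraph.dist_le_diam (by
      have := hG.nonempty
      exact SimpleGraph.connected_iff_ediam_ne_top.1 hG)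
  obtain ⟨m, rfl⟩ : ∃ m, D = m + 1 := by
    refine ⟨D - 1, ?_⟩
    have := Fintype.card_pos_iff.2 ⟨x⟩
    rcases D with _ | D
    · simp at hcard
      omega
    · rfl
  have hcard' : Fintype.card V = 2 * ∑ k ∈ Finset.range (m + 1), q ^ k := by
    rw [hcard, Nat.geomSum_eq (by omega), show q + 1 - 2 = q - 1 by omega, Nat.add_sub_cancel,
      Nat.mul_div_assoc]
    simpa using Nat.sub_dvd_pow_sub_pow q 1 (m + 1)
  have hmem : ∀ u v, G.Adj u v → ¬(u ∈ V1 ↔ v ∈ V1) := by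
    intro u v h
    rw [Set.disjoint_left] at hdisj
    have := @hdisj u
    have := @hdisj v
    have := hbip u v h
    tauto
  let c : G.Coloring Bool := SimpleGraph.Coloring.mk (fun v => decide (v ∈ V1)) fun {u v} h => by
    simpa using hmem u v h
  have hdeg : Fintype.card (G.neighborSet y) = q + 1 := by
    rw [SimpleGraph.card_neighborSet_eq_degree]
    exact hreg y
  let e : Fin (q + 1) ≃ G.neighborSet y := (Fintype.equivFinOfCardEq hdeg).symm
  have hadj : ∀ i, G.Adj (e i) y := fun i => (e i).2.symm
  have hpath : ∀ i, ∃ p : G.Walk x (e i), p.length = m := by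
    intro i
    obtain ⟨p, hp⟩ := hG.exists_walk_length_eq_dist x (e i)
    refine ⟨p, ?_⟩
    have h1 := c.dist_succ_of_adj hG x (hadj i)
    have h2 := hle x (e i)
    omega
  choose p hp using hpath
  refine ⟨fun i => (p i).concat (hadj i), fun i => ?_, ?_⟩
  · have hlen : ((p i).concat (hadj i)).length = m + 1 := by rw [SimpleGraph.Walk.length_concat, hp]
    exact ⟨SimpleGraph.Walk.isPath_of_length_eq_dist _ (hlen.trans hxy.symm), hlen⟩
  · intro i j hij v hi hj
    by_contra! hv
    simp only [SimpleGraph.Walk.support_concat, List.mem_append, List.mem_singleton,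
      hv.2, or_false] at hi hj
    obtain ⟨h1, h2⟩ := hG.dist_add_dist_eq_of_mem_support hxy (hadj i) (p i) (hp i) hi
    obtain ⟨h3, h4⟩ := hG.dist_add_dist_eq_of_mem_support hxy (hadj j) (p j) (hp j) hj
    have h5 := hG.pos_dist_of_ne hv.1.symm
    exact hij (e.injective (Subtype.ext (c.eq_of_adj_of_dist_of_card_eq hG hreg hle hcard'
      (by omega) h1 rfl (hadj i) (by omega) (hadj j))))
end
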